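/- arXiv:2308.12159 — 2 statements merged into one kernel-verified Lean document; each statement's English description precedes it below -/
import Mathlib

section
/- Let G ∈ S_n^{r,t} be a connected bicyclic graph of order n with 10 ≤ n ≤ 15, whose two cycles have lengths r and t and share exactly one common vertex. Then ABC_GG(G) ≤ 2·(sqrt(2/3) + sqrt((n−5)/(n−4)) + sqrt((n−3)/(3(n−4)))) + (n−5)·sqrt((n−2)/(n−1)), with equality if and only if G = S_n^{3,3}(2, 2, n−9). -/
/-- `sideCount G u v` is the number of vertices of `G` whose distance to `u`
is strictly smaller than their distance to `v`. -/
noncomputable def sideCount {V : Type*} [Fintype V] (G : SimpleGraph V) (u v : V) : ℕ :=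
  Nat.card {w : V // G.dist w u < G.dist w v}

open Classical in
/-- The Graovac–Ghorbani index
`ABC_GG(G) = Σ_{uv ∈ E(G)} sqrt ((n_u + n_v - 2) / (n_u * n_v))`,
computed as half the sum over ordered adjacent pairs. -/
noncomputable def ABCGG {V : Type*} [Fintype V] (G : SimpleGraph V) : ℝ :=
  (1 / 2) * ∑ u : V, ∑ v : V,
    if G.Adj u v then
      Real.sqrt (((sideCount G u v : ℝ) + (sideCount G v u : ℝ) - 2) /
        ((sideCount G u v : ℝ) * (sideCount G v u : ℝ)))
    else 0

/-- `G ∈ S_n^{r,t}`: `G` is a bicyclic graph of order `n` possessing two cycles, of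
lengths `r` and `t`, sharing exactly one common vertex. -/
def InSnrt {V : Type*} [Fintype V] (G : SimpleGraph V) (n r t : ℕ) : Prop :=
  Fintype.card V = n ∧ G.Connected ∧ G.edgeSet.ncard = n + 1 ∧
  ∃ (a b : V) (c1 : G.Walk a a) (c2 : G.Walk b b),
    c1.IsCycle ∧ c2.IsCycle ∧ c1.length = r ∧ c2.length = t ∧
    ({v | v ∈ c1.support} ∩ {v | v ∈ c2.support}).ncard = 1

/-- Vertex type for `S_n^{3,3}(m1,m2,n1,n2,m0)`: the five cycle vertices
(`0` = common vertex `u`, `1,2` = the other vertices of the first triangle,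
`3,4` = the other vertices of the second triangle) together with the pendent
vertices. -/
abbrev SVert (m1 m2 n1 n2 m0 : ℕ) : Type :=
  Fin 5 ⊕ Fin m1 ⊕ Fin m2 ⊕ Fin n1 ⊕ Fin n2 ⊕ Fin m0

/-- The graph `S_n^{3,3}(m1,m2,n1,n2,m0)`: two triangles sharing exactly the vertex `u`,
with `m1, m2` pendent vertices attached to the two non-common vertices of the first
triangle, `n1, n2` pendent vertices attached to those of the second triangle, and
`m0` pendent vertices attached to `u`.  `S_n^{3,3}(m1,n1,m0)` is `S33 m1 0 n1 0 m0`. -/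
def S33 (m1 m2 n1 n2 m0 : ℕ) : SimpleGraph (SVert m1 m2 n1 n2 m0) :=
  SimpleGraph.fromRel (fun x y =>
    (x = Sum.inl 0 ∧ y = Sum.inl 1) ∨
    (x = Sum.inl 1 ∧ y = Sum.inl 2) ∨
    (x = Sum.inl 2 ∧ y = Sum.inl 0) ∨
    (x = Sum.inl 0 ∧ y = Sum.inl 3) ∨
    (x = Sum.inl 3 ∧ y = Sum.inl 4) ∨
    (x = Sum.inl 4 ∧ y = Sum.inl 0) ∨
    (∃ i : Fin m1, x = Sum.inl 1 ∧ y = Sum.inr (Sum.inl i)) ∨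
    (∃ i : Fin m2, x = Sum.inl 2 ∧ y = Sum.inr (Sum.inr (Sum.inl i))) ∨
    (∃ i : Fin n1, x = Sum.inl 3 ∧ y = Sum.inr (Sum.inr (Sum.inr (Sum.inl i)))) ∨
    (∃ i : Fin n2, x = Sum.inl 4 ∧ y = Sum.inr (Sum.inr (Sum.inr (Sum.inr (Sum.inl i))))) ∨
    (∃ i : Fin m0, x = Sum.inl 0 ∧ y = Sum.inr (Sum.inr (Sum.inr (Sum.inr (Sum.inr i))))))

/-- The contribution `√((a + b - 2) / (a b))` of an edge whose sides have sizes `a` and `b`. -/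
noncomputable def edgeTerm (a b : ℕ) : ℝ :=
  Real.sqrt (((a : ℝ) + (b : ℝ) - 2) / ((a : ℝ) * (b : ℝ)))

lemma edgeTerm_comm (a b : ℕ) : edgeTerm a b = edgeTerm b a := by
  unfold edgeTerm; rw [add_comm (a : ℝ), mul_comm (a : ℝ)]

lemma cast_edgeTerm_radicand {a b : ℕ} (ha : 1 ≤ a) (hb : 1 ≤ b) :
    ((a : ℝ) + (b : ℝ) - 2) / ((a : ℝ) * (b : ℝ)) = ((a + b - 2 : ℕ) : ℝ) / ((a * b : ℕ) : ℝ) := by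
  rw [Nat.cast_sub (by omega)]; push_cast; ring

/-- `⌊10⁵ √((a + b - 2) / (a b))⌋`. -/
def scaledTerm (a b : ℕ) : ℕ := Nat.sqrt (10 ^ 10 * (a + b - 2) / (a * b))

lemma edgeTerm_lt_scaledTerm {a b : ℕ} (ha : 1 ≤ a) (hb : 1 ≤ b) :
    edgeTerm a b < ((scaledTerm a b + 1 : ℕ) : ℝ) / 10 ^ 5 := by
  have hab : 0 < a * b := Nat.mul_pos ha hb
  have h1 : 10 ^ 10 * (a + b - 2) < (scaledTerm a b + 1) * (scaledTerm a b + 1) * (a * b) :=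
    (Nat.div_lt_iff_lt_mul hab).1 (Nat.sqrt_lt.1 (Nat.lt_succ_self _))
  rw [edgeTerm, cast_edgeTerm_radicand ha hb, Real.sqrt_lt' (by positivity),
    div_lt_iff₀ (by exact_mod_cast hab)]
  have h2 : (10 ^ 10 * ((a + b - 2 : ℕ) : ℝ)) <
      ((scaledTerm a b + 1 : ℕ) : ℝ) * ((scaledTerm a b + 1 : ℕ) : ℝ) * ((a * b : ℕ) : ℝ) := by
    exact_mod_cast h1
  rw [div_pow, div_mul_eq_mul_div, lt_div_iff₀ (by positivity)]
  linarith

lemma scaledTerm_le_edgeTerm {a b : ℕ} (ha : 1 ≤ a) (hb : 1 ≤ b) :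
    (scaledTerm a b : ℝ) / 10 ^ 5 ≤ edgeTerm a b := by
  have hab : 0 < a * b := Nat.mul_pos ha hb
  have h1 : scaledTerm a b * scaledTerm a b * (a * b) ≤ 10 ^ 10 * (a + b - 2) :=
    (Nat.le_div_iff_mul_le hab).1 (Nat.sqrt_le _)
  rw [edgeTerm, cast_edgeTerm_radicand ha hb]
  apply Real.le_sqrt_of_sq_le
  rw [le_div_iff₀ (by exact_mod_cast hab)]
  have h2 : (scaledTerm a b : ℝ) * (scaledTerm a b : ℝ) * ((a * b : ℕ) : ℝ) ≤
      10 ^ 10 * ((a + b - 2 : ℕ) : ℝ) := by exact_mod_cast h1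
  rw [div_pow, div_mul_eq_mul_div, div_le_iff₀ (by positivity)]
  linarith

/-- The sizes `a`, `b`, `c` include both `1` and `3`. -/
def OptimalParts (a b c : ℕ) : Prop :=
  (a = 1 ∧ b = 3) ∨ (a = 3 ∧ b = 1) ∨ (b = 1 ∧ c = 3) ∨ (b = 3 ∧ c = 1) ∨
    (a = 1 ∧ c = 3) ∨ (a = 3 ∧ c = 1)

instance (a b c : ℕ) : Decidable (OptimalParts a b c) := by
  unfold OptimalParts; infer_instance

lemma scaledTerm_triangle : ∀ n ∈ Finset.Icc 10 15, ∀ a ∈ Finset.Ico 1 n, ∀ b ∈ Finset.Ico 1 (n - a),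
    ¬ OptimalParts a b (n - a - b) →
    scaledTerm a b + scaledTerm b (n - a - b) + scaledTerm (n - a - b) a + 3 <
      scaledTerm 1 3 + scaledTerm 1 (n - 4) + scaledTerm 3 (n - 4) := by
  decide +kernel

/-- The contribution of a triangle with parts of sizes `1`, `3` and `n - 4`. -/
noncomputable def optimalTriangle (n : ℕ) : ℝ :=
  edgeTerm 1 3 + edgeTerm 1 (n - 4) + edgeTerm 3 (n - 4)

lemma triangle_lt_optimalTriangle {n a b c : ℕ} (hn1 : 10 ≤ n) (hn2 : n ≤ 15) (ha : 1 ≤ a)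
    (hb : 1 ≤ b) (hc : 1 ≤ c) (h : a + b + c = n) (ho : ¬ OptimalParts a b c) :
    edgeTerm a b + edgeTerm b c + edgeTerm c a < optimalTriangle n := by
  obtain rfl : c = n - a - b := by omega
  have key := scaledTerm_triangle n (Finset.mem_Icc.2 ⟨hn1, hn2⟩) a
    (Finset.mem_Ico.2 (by omega)) b (Finset.mem_Ico.2 (by omega)) ho
  have h1 := edgeTerm_lt_scaledTerm ha hb
  have h2 := edgeTerm_lt_scaledTerm hb hc
  have h3 := edgeTerm_lt_scaledTerm hc ha
  have h4 := scaledTerm_le_edgeTerm (a := 1) (b := 3) le_rfl (by norm_num)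
  have h5 := scaledTerm_le_edgeTerm (a := 1) (b := n - 4) le_rfl (by omega)
  have h6 := scaledTerm_le_edgeTerm (a := 3) (b := n - 4) (by norm_num) (by omega)
  have key' : (scaledTerm a b : ℝ) + scaledTerm b (n - a - b) + scaledTerm (n - a - b) a + 3 <
      scaledTerm 1 3 + scaledTerm 1 (n - 4) + scaledTerm 3 (n - 4) := by exact_mod_cast key
  push_cast at h1 h2 h3
  unfold optimalTriangle
  linarith

lemma triangle_eq_optimalTriangle {n a b c : ℕ} (h : a + b + c = n) (ho : OptimalParts a b c) :
    edgeTerm a b + edgeTerm b c + edgeTerm c a = optimalTriangle n := by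
  unfold optimalTriangle
  have h1 := edgeTerm_comm (n - 4) 1
  have h2 := edgeTerm_comm (n - 4) 3
  have h3 := edgeTerm_comm 3 1
  rcases ho with ⟨rfl, rfl⟩ | ⟨rfl, rfl⟩ | ⟨rfl, rfl⟩ | ⟨rfl, rfl⟩ | ⟨rfl, rfl⟩ | ⟨rfl, rfl⟩
  · obtain rfl : c = n - 4 := by omega
    linarith
  · obtain rfl : c = n - 4 := by omega
    linarith
  · obtain rfl : a = n - 4 := by omega
    linarith
  · obtain rfl : a = n - 4 := by omega
    linarith
  · obtain rfl : b = n - 4 := by omega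
    linarith
  · obtain rfl : b = n - 4 := by omega
    linarith

lemma edgeTerm_sq {a b : ℕ} (ha : 1 ≤ a) (hb : 1 ≤ b) :
    edgeTerm a b ^ 2 = ((a : ℝ) + (b : ℝ) - 2) / ((a : ℝ) * (b : ℝ)) := by
  rw [edgeTerm, Real.sq_sqrt]
  rw [cast_edgeTerm_radicand ha hb]
  positivity

lemma edgeTerm_nonneg (a b : ℕ) : 0 ≤ edgeTerm a b := Real.sqrt_nonneg _

lemma edgeTerm_pendent_sub_sq {n a b : ℕ} (hn : 2 ≤ n) (ha : 1 ≤ a) (hb : 1 ≤ b) :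
    (edgeTerm 1 (n - 1) ^ 2 - edgeTerm a b ^ 2) * (((n : ℝ) - 1) * (a * b)) =
      ((n : ℝ) - 2) * (((a : ℝ) - 1) * (b - 1)) + (n - a - b) := by
  have h1 : (1 : ℝ) ≤ a := by exact_mod_cast ha
  have h2 : (1 : ℝ) ≤ b := by exact_mod_cast hb
  have h3 : (2 : ℝ) ≤ n := by exact_mod_cast hn
  have h4 : (n : ℝ) - 1 ≠ 0 := by linarith
  have h5 : (a : ℝ) ≠ 0 := by linarith
  have h6 : (b : ℝ) ≠ 0 := by linarith
  rw [edgeTerm_sq ha hb, edgeTerm_sq le_rfl (by omega), Nat.cast_sub (by omega)]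
  push_cast
  field_simp
  ring

lemma edgeTerm_le_pendent {n a b : ℕ} (hn : 2 ≤ n) (ha : 1 ≤ a) (hb : 1 ≤ b) (h : a + b ≤ n) :
    edgeTerm a b ≤ edgeTerm 1 (n - 1) := by
  have h1 : (1 : ℝ) ≤ a := by exact_mod_cast ha
  have h2 : (1 : ℝ) ≤ b := by exact_mod_cast hb
  have h3 : (2 : ℝ) ≤ n := by exact_mod_cast hn
  have h4 : (a : ℝ) + b ≤ n := by exact_mod_cast h
  have key := edgeTerm_pendent_sub_sq hn ha hb
  have h5 : 0 ≤ ((n : ℝ) - 2) * (((a : ℝ) - 1) * (b - 1)) :=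
    mul_nonneg (by linarith) (mul_nonneg (by linarith) (by linarith))
  have h6 : 0 < ((n : ℝ) - 1) * (a * b) := mul_pos (by linarith) (by positivity)
  refine (pow_le_pow_iff_left₀ (edgeTerm_nonneg _ _) (edgeTerm_nonneg _ _) two_ne_zero).1 ?_
  by_contra! hlt
  nlinarith [mul_pos (sub_pos.2 hlt) h6]

lemma parts_of_edgeTerm_eq_pendent {n a b : ℕ} (hn : 3 ≤ n) (ha : 1 ≤ a) (hb : 1 ≤ b)
    (h : a + b ≤ n) (heq : edgeTerm a b = edgeTerm 1 (n - 1)) : a + b = n ∧ (a = 1 ∨ b = 1) := by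
  have h1 : (1 : ℝ) ≤ a := by exact_mod_cast ha
  have h2 : (1 : ℝ) ≤ b := by exact_mod_cast hb
  have h3 : (3 : ℝ) ≤ n := by exact_mod_cast hn
  have h4 : (a : ℝ) + b ≤ n := by exact_mod_cast h
  have key := edgeTerm_pendent_sub_sq (by omega) ha hb (n := n)
  have h5 : 0 ≤ ((a : ℝ) - 1) * (b - 1) := mul_nonneg (by linarith) (by linarith)
  rw [heq, sub_self, zero_mul] at key
  have h6 : 0 ≤ ((n : ℝ) - 2) * (((a : ℝ) - 1) * (b - 1)) := mul_nonneg (by linarith) h5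
  constructor
  · have : (n : ℝ) = a + b := by linarith
    exact_mod_cast this.symm
  · have h7 : ((n : ℝ) - 2) * (((a : ℝ) - 1) * (b - 1)) = 0 := by linarith
    rcases mul_eq_zero.1 h7 with h8 | h8
    · linarith
    · rcases mul_eq_zero.1 h8 with h9 | h9
      · left; exact_mod_cast (sub_eq_zero.1 h9)
      · right; exact_mod_cast (sub_eq_zero.1 h9)

lemma edgeTerm_le_of_two_le {a b : ℕ} (ha : 2 ≤ a) (hb : 2 ≤ b) : edgeTerm a b ≤ 0.708 := by
  have ha' : (2 : ℝ) ≤ a := by exact_mod_cast ha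
  have hb' : (2 : ℝ) ≤ b := by exact_mod_cast hb
  unfold edgeTerm
  rw [Real.sqrt_le_left (by norm_num), div_le_iff₀ (by positivity)]
  nlinarith [mul_nonneg (sub_nonneg.2 ha') (sub_nonneg.2 hb')]

lemma le_edgeTerm_pendent {n : ℕ} (hn : 10 ≤ n) : 0.94 ≤ edgeTerm 1 (n - 1) := by
  have h : (10 : ℝ) ≤ n := by exact_mod_cast hn
  unfold edgeTerm
  apply Real.le_sqrt_of_sq_le
  rw [Nat.cast_sub (by omega)]
  push_cast
  rw [le_div_iff₀ (by linarith)]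
  linarith

lemma le_optimalTriangle {n : ℕ} (hn : 10 ≤ n) : 2.2 ≤ optimalTriangle n := by
  have h : (10 : ℝ) ≤ n := by exact_mod_cast hn
  have h1 : 0.8 ≤ edgeTerm 1 3 := by
    unfold edgeTerm
    apply Real.le_sqrt_of_sq_le
    norm_num
  have h2 : 0.9 ≤ edgeTerm 1 (n - 4) := by
    unfold edgeTerm
    apply Real.le_sqrt_of_sq_le
    rw [Nat.cast_sub (by omega)]
    push_cast
    rw [le_div_iff₀ (by linarith)]
    linarith
  have h3 : 0.5 ≤ edgeTerm 3 (n - 4) := by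
    unfold edgeTerm
    apply Real.le_sqrt_of_sq_le
    rw [Nat.cast_sub (by omega)]
    push_cast
    rw [le_div_iff₀ (by linarith)]
    linarith
  unfold optimalTriangle
  linarith

lemma bound_eq {n : ℕ} (hn : 10 ≤ n) :
    2 * (Real.sqrt (2 / 3) + Real.sqrt (((n : ℝ) - 5) / ((n : ℝ) - 4)) +
        Real.sqrt (((n : ℝ) - 3) / (3 * ((n : ℝ) - 4)))) +
      ((n : ℝ) - 5) * Real.sqrt (((n : ℝ) - 2) / ((n : ℝ) - 1)) =
    2 * optimalTriangle n + ((n : ℝ) - 5) * edgeTerm 1 (n - 1) := by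
  unfold optimalTriangle edgeTerm
  rw [Nat.cast_sub (by omega), Nat.cast_sub (by omega)]
  push_cast
  congr 5 <;> ring_nf

section

open SimpleGraph

variable {V : Type*}

/-- Two closed walks with at most one common vertex. -/
def MeetOnce {G : SimpleGraph V} {a b : V} (c₁ : G.Walk a a) (c₂ : G.Walk b b) : Prop :=
  ∀ v w, v ∈ c₁.support → w ∈ c₁.support → v ∈ c₂.support → w ∈ c₂.support → v = w

lemma MeetOnce.symm {G : SimpleGraph V} {a b : V} {c₁ : G.Walk a a} {c₂ : G.Walk b b}
    (h : MeetOnce c₁ c₂) : MeetOnce c₂ c₁ := fun v w h1 h2 h3 h4 => h v w h3 h4 h1 h2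

lemma MeetOnce.notMem_edges {G : SimpleGraph V} {a b : V} {c₁ : G.Walk a a} {c₂ : G.Walk b b}
    (h : MeetOnce c₁ c₂) {v w : V} (hne : v ≠ w) (hv : v ∈ c₁.support) (hw : w ∈ c₁.support) :
    s(v, w) ∉ c₂.edges := fun he =>
  hne (h v w hv hw (c₂.fst_mem_support_of_mem_edges he) (c₂.snd_mem_support_of_mem_edges he))

lemma MeetOnce.disjoint_edges {G : SimpleGraph V} {a b : V} {c₁ : G.Walk a a} {c₂ : G.Walk b b}
    (h : MeetOnce c₁ c₂) {e : Sym2 V} (he : e ∈ c₁.edges) : e ∉ c₂.edges := by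
  induction e with
  | _ v w =>
    exact h.notMem_edges (c₁.adj_of_mem_edges he).ne (c₁.fst_mem_support_of_mem_edges he)
      (c₁.snd_mem_support_of_mem_edges he)

lemma connected_deleteEdge_of_mem_cycle {G : SimpleGraph V} (hG : G.Connected) {a : V}
    {c : G.Walk a a} (hc : c.IsCycle) {e : Sym2 V} (he : e ∈ c.edges) :
    (G.deleteEdges {e}).Connected := by
  induction e with
  | _ v w =>
    exact hG.connected_delete_edge_of_not_isBridge fun hb => hb.notMem_edges_of_isCycle hc he

lemma reachable_deleteEdge_of_not_isBridge {G : SimpleGraph V} {p q u v : V}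
    (hb : ¬ G.IsBridge s(p, q)) (h : G.Reachable u v) : (G.deleteEdges {s(p, q)}).Reachable u v := by
  rw [isBridge_iff, not_not] at hb
  obtain ⟨w⟩ := h
  induction w with
  | nil => exact Reachable.refl _
  | @cons u u' v hadj w ih =>
    refine Reachable.trans ?_ ih
    by_cases he : s(u, u') = s(p, q)
    · rcases Sym2.eq_iff.1 he with ⟨rfl, rfl⟩ | ⟨rfl, rfl⟩
      exacts [hb, hb.symm]
    · exact Adj.reachable (deleteEdges_adj.2 ⟨hadj, he⟩)

lemma exists_mem_edges_of_isCycle {G : SimpleGraph V} {a : V} {c : G.Walk a a} (hc : c.IsCycle) :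
    ∃ e, e ∈ c.edges := by
  have h1 := hc.three_le_length
  have h2 := c.length_edges
  exact List.exists_mem_of_length_pos (by omega)

lemma isAcyclic_deleteEdges_pair [Finite V] {G : SimpleGraph V} (hG : G.Connected)
    (hcard : G.edgeSet.ncard = Nat.card V + 1) {a b : V} {c₁ : G.Walk a a} {c₂ : G.Walk b b}
    (h₁ : c₁.IsCycle) (h₂ : c₂.IsCycle) (hm : MeetOnce c₁ c₂) {e₁ e₂ : Sym2 V}
    (he₁ : e₁ ∈ c₁.edges) (he₂ : e₂ ∈ c₂.edges) : (G.deleteEdges {e₁, e₂}).IsAcyclic := by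
  have hne : e₁ ≠ e₂ := fun h => hm.disjoint_edges he₁ (h ▸ he₂)
  have hc1 := connected_deleteEdge_of_mem_cycle hG h₁ he₁
  have hmem : ∀ e ∈ c₂.edges, e ∈ (G.deleteEdges {e₁}).edgeSet := fun e he => by
    rw [edgeSet_deleteEdges]
    exact ⟨c₂.edges_subset_edgeSet he, fun h => hm.disjoint_edges he₁ (h ▸ he)⟩
  have hc2 := connected_deleteEdge_of_mem_cycle hc1 (h₂.transfer hmem) (e := e₂)
    (by rwa [Walk.edges_transfer])
  rw [deleteEdges_deleteEdges, Set.singleton_union] at hc2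
  refine (isTree_iff_connected_and_card.2 ⟨hc2, ?_⟩).isAcyclic
  rw [Nat.card_coe_set_eq, edgeSet_deleteEdges, Set.ncard_sdiff, Set.ncard_pair hne]
  · rw [hcard]; have := hG.nonempty; have := Nat.card_pos (α := V); omega
  · rintro e (rfl | rfl)
    exacts [c₁.edges_subset_edgeSet he₁, c₂.edges_subset_edgeSet he₂]

lemma IsAcyclic.not_adj_of_adj_adj {G : SimpleGraph V} (hG : G.IsAcyclic) {x y z : V}
    (h1 : G.Adj x y) (h2 : G.Adj x z) : ¬ G.Adj y z := fun h3 => by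
  classical
  exact hG.cliqueFree le_rfl {x, y, z} (is3Clique_triple_iff.2 ⟨h1, h2, h3⟩)

lemma two_le_sideCount [Fintype V] {G : SimpleGraph V} {u v w : V} (huv : G.Adj u v)
    (huw : G.Adj u w) (hne : w ≠ v) (hG : G.Connected) (hnot : ¬ G.Adj w v) :
    2 ≤ sideCount G u v := by
  have hu : G.dist u u < G.dist u v := by
    rw [SimpleGraph.dist_self]; exact hG.pos_dist_of_ne huv.ne
  have hw : G.dist w u < G.dist w v := by
    rw [dist_eq_one_iff_adj.2 huw.symm]
    exact hG.one_lt_dist_of_ne_of_not_adj hne hnot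
  unfold sideCount
  rw [Nat.card_eq_fintype_card]
  exact Fintype.one_lt_card_iff.2 ⟨⟨u, hu⟩, ⟨w, hw⟩, fun h => huw.ne (congrArg Subtype.val h)⟩

lemma two_le_sideCount_of_mem_cycle [Fintype V] {G : SimpleGraph V} (hG : G.Connected)
    (hcard : G.edgeSet.ncard = Nat.card V + 1) {a b : V} {c₁ : G.Walk a a} {c₂ : G.Walk b b}
    (h₁ : c₁.IsCycle) (h₂ : c₂.IsCycle) (hm : MeetOnce c₁ c₂) (hlen : 4 ≤ c₁.length) {u v : V}
    (he : s(u, v) ∈ c₁.edges) : 2 ≤ sideCount G u v := by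
  classical
  have hu := c₁.fst_mem_support_of_mem_edges he
  have hv := c₁.snd_mem_support_of_mem_edges he
  have huv := c₁.adj_of_mem_edges he
  obtain ⟨w, hw, hwv⟩ := Set.exists_ne_of_one_lt_ncard
    (by rw [h₁.ncard_neighborSet_toSubgraph_eq_two hu]; norm_num :
      1 < (c₁.toSubgraph.neighborSet u).ncard) v
  have hew : s(u, w) ∈ c₁.edges := by
    simpa [Subgraph.mem_neighborSet, ← Subgraph.mem_edgeSet, Walk.mem_edges_toSubgraph] using hw
  have huw := c₁.adj_of_mem_edges hew
  have hws := c₁.snd_mem_support_of_mem_edges hew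
  refine two_le_sideCount huv huw hwv hG fun hadj => ?_
  obtain ⟨e₁, he₁, hne₁⟩ : ∃ e ∈ c₁.edges.toFinset, e ∉ ({s(u, v), s(u, w), s(v, w)} : Finset _) := by
    refine Finset.exists_mem_notMem_of_card_lt_card (lt_of_le_of_lt Finset.card_le_three ?_)
    rw [List.toFinset_card_of_nodup h₁.isTrail.edges_nodup, Walk.length_edges]
    omega
  obtain ⟨e₂, he₂⟩ := exists_mem_edges_of_isCycle h₂
  simp only [List.mem_toFinset] at he₁
  simp only [Finset.mem_insert, Finset.mem_singleton, not_or] at hne₁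
  have hac := isAcyclic_deleteEdges_pair hG hcard h₁ h₂ hm he₁ he₂
  have hin : ∀ {p q : V}, G.Adj p q → s(p, q) ≠ e₁ → p ∈ c₁.support → q ∈ c₁.support →
      (G.deleteEdges {e₁, e₂}).Adj p q := fun hpq h hp hq => by
    rw [deleteEdges_adj]
    refine ⟨hpq, ?_⟩
    rintro (h' | h')
    · exact h h'
    · exact hm.notMem_edges hpq.ne hp hq (h' ▸ he₂)
  exact IsAcyclic.not_adj_of_adj_adj hac (hin huv (Ne.symm hne₁.1) hu hv)
    (hin huw (Ne.symm hne₁.2.1) hu hws) (hin hadj.symm (Ne.symm hne₁.2.2) hv hws)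

/-- `κ` sends every vertex to the vertex of the triangle `x y z` through which it is attached. -/
structure IsGate (G : SimpleGraph V) (x y z : V) (κ : V → V) : Prop where
  xy : G.Adj x y
  yz : G.Adj y z
  zx : G.Adj z x
  mem : ∀ w, κ w = x ∨ κ w = y ∨ κ w = z
  fst : κ x = x
  snd : κ y = y
  trd : κ z = z
  adj : ∀ p q, G.Adj p q → κ p = κ q ∨ (p = κ p ∧ q = κ q)

lemma IsGate.rotate {G : SimpleGraph V} {x y z : V} {κ : V → V} (h : IsGate G x y z κ) :
    IsGate G y z x κ :=
  ⟨h.yz, h.zx, h.xy, fun w => by have := h.mem w; tauto, h.snd, h.trd, h.fst, h.adj⟩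

lemma IsGate.reflect {G : SimpleGraph V} {x y z : V} {κ : V → V} (h : IsGate G x y z κ) :
    IsGate G x z y κ :=
  ⟨h.zx.symm, h.yz.symm, h.xy.symm, fun w => by have := h.mem w; tauto, h.fst, h.trd, h.snd, h.adj⟩

lemma IsGate.dist_lt_length {G : SimpleGraph V} {x y z : V} {κ : V → V} (hG : G.Connected)
    (h : IsGate G x y z κ) {w t : V} (p : G.Walk w t) (ht : κ t = t) (hne : κ w ≠ t) :
    G.dist w (κ w) + 1 ≤ p.length := by
  induction p with
  | nil => exact absurd ht hne
  | @cons w w' t hadj p ih =>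
    rw [Walk.length_cons]
    rcases h.adj _ _ hadj with heq | ⟨heq, -⟩
    · have h1 := ih ht (heq ▸ hne)
      have h2 := hG.dist_triangle (u := w) (v := w') (w := κ w)
      rw [dist_eq_one_iff_adj.2 hadj, heq] at h2
      rw [heq]
      omega
    · rw [← heq, SimpleGraph.dist_self]; omega

lemma IsGate.dist_eq {G : SimpleGraph V} {x y z : V} {κ : V → V} (hG : G.Connected)
    (h : IsGate G x y z κ) {w t : V} (ht : t = x ∨ t = y ∨ t = z) (hne : κ w ≠ t) :
    G.dist w t = G.dist w (κ w) + 1 := by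
  have hκ : κ t = t := by rcases ht with rfl | rfl | rfl; exacts [h.fst, h.snd, h.trd]
  apply le_antisymm
  · have h2 := hG.dist_triangle (u := w) (v := κ w) (w := t)
    have h3 : G.Adj (κ w) t := by
      have h1 := h.xy; have h2 := h.yz; have h3 := h.zx
      rcases h.mem w with h4 | h4 | h4 <;> rcases ht with rfl | rfl | rfl <;> rw [h4] at hne ⊢ <;>
        first | exact absurd rfl hne | assumption | (apply SimpleGraph.Adj.symm; assumption)
    rwa [dist_eq_one_iff_adj.2 h3] at h2
  · obtain ⟨p, hp⟩ := hG.exists_walk_length_eq_dist w t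
    rw [← hp]
    exact h.dist_lt_length hG p hκ hne

lemma IsGate.sideCount_eq [Fintype V] {G : SimpleGraph V} {x y z : V} {κ : V → V}
    (hG : G.Connected) (h : IsGate G x y z κ) : sideCount G x y = Nat.card {w // κ w = x} := by
  unfold sideCount
  refine Nat.card_congr (Equiv.subtypeEquivRight fun w => ?_)
  have h1 := h.dist_eq hG (w := w) (t := x) (by simp)
  have h2 := h.dist_eq hG (w := w) (t := y) (by simp)
  have hxy := h.xy.ne
  by_cases hx : κ w = x
  · have := h2 (by rw [hx]; exact hxy)
    rw [hx] at this
    simp only [hx, iff_true]; omega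
  · have := h1 hx
    simp only [hx, iff_false]
    by_cases hy : κ w = y
    · rw [hy] at this; omega
    · have := h2 hy; omega

lemma IsGate.card_add_card_add_card [Fintype V] {G : SimpleGraph V} {x y z : V} {κ : V → V}
    (h : IsGate G x y z κ) :
    Nat.card {w // κ w = x} + Nat.card {w // κ w = y} + Nat.card {w // κ w = z} = Nat.card V := by
  classical
  simp only [Nat.card_eq_fintype_card, Fintype.card_subtype]
  rw [← Finset.card_union_of_disjoint, ← Finset.card_union_of_disjoint]
  · rw [← Finset.card_univ]
    congr 1
    ext w
    simpa [or_assoc] using h.mem w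
  · rw [Finset.disjoint_left]
    intro w
    simp only [Finset.mem_union, Finset.mem_filter, Finset.mem_univ, true_and]
    have h1 := h.yz.ne
    have h2 := h.zx.ne
    rintro (h3 | h3) <;> rw [h3]
    exacts [h2.symm, h1]
  · rw [Finset.disjoint_left]
    intro w
    simp only [Finset.mem_filter, Finset.mem_univ, true_and]
    intro h3
    rw [h3]
    exact h.xy.ne

lemma not_reachable_deleteEdges_triangle [Finite V] {G : SimpleGraph V} (hG : G.Connected)
    (hcard : G.edgeSet.ncard = Nat.card V + 1) {a b : V} {c₁ : G.Walk a a} {c₂ : G.Walk b b}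
    (h₁ : c₁.IsCycle) (h₂ : c₂.IsCycle) (hm : MeetOnce c₁ c₂) {x y z : V}
    (hxy : s(x, y) ∈ c₁.edges) (hyz : s(y, z) ∈ c₁.edges) (hzx : s(z, x) ∈ c₁.edges) :
    ¬ (G.deleteEdges {s(x, y), s(y, z), s(z, x)}).Reachable x y := by
  intro hr
  have axy := c₁.adj_of_mem_edges hxy
  have ayz := c₁.adj_of_mem_edges hyz
  have azx := c₁.adj_of_mem_edges hzx
  obtain ⟨e₂, he₂⟩ := exists_mem_edges_of_isCycle h₂
  have hac := isAcyclic_deleteEdges_pair hG hcard h₁ h₂ hm hxy he₂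
  set H := G.deleteEdges {s(x, y), s(y, z), s(z, x)} with hH
  have hmem : ∀ e ∈ c₂.edges, e ∈ H.edgeSet := fun e he => by
    rw [edgeSet_deleteEdges]
    refine ⟨c₂.edges_subset_edgeSet he, ?_⟩
    rintro (rfl | rfl | rfl)
    exacts [hm.disjoint_edges hxy he, hm.disjoint_edges hyz he, hm.disjoint_edges hzx he]
  have hr2 : (H.deleteEdges {e₂}).Reachable x y := by
    induction e₂ with
    | _ p q =>
      have hnb : ¬ H.IsBridge s(p, q) := fun hb =>
        hb.notMem_edges_of_isCycle (h₂.transfer hmem) (by rwa [Walk.edges_transfer])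
      exact reachable_deleteEdge_of_not_isBridge hnb hr
  have hne₂ : ∀ {e}, e ∈ c₁.edges → e ≠ e₂ := fun he h => hm.disjoint_edges he (h ▸ he₂)
  have hb := isAcyclic_iff_forall_adj_isBridge.1 hac (v := z) (w := x) (by
    rw [deleteEdges_adj]
    refine ⟨azx, ?_⟩
    rintro (h | h)
    · have := axy.ne; have := ayz.ne; have := azx.ne
      simp at h; grind
    · exact hne₂ hzx h)
  rw [isBridge_iff] at hb
  apply hb
  refine Reachable.trans (v := y) (Adj.reachable ?_) (hr2.symm.mono ?_)
  · simp only [deleteEdges_adj, Set.mem_insert_iff, Set.mem_singleton_iff]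
    refine ⟨⟨ayz.symm, ?_⟩, ?_⟩
    · rintro (h | h)
      · have := axy.ne; have := ayz.ne; have := azx.ne
        simp at h; grind
      · exact hne₂ hyz (by rw [Sym2.eq_swap]; exact h)
    · have := axy.ne; have := ayz.ne; have := azx.ne
      intro h
      simp at h; grind
  · rw [hH, deleteEdges_deleteEdges, deleteEdges_deleteEdges]
    apply deleteEdges_anti
    intro e
    simp only [Set.mem_union, Set.mem_insert_iff, Set.mem_singleton_iff]
    tauto

lemma exists_isGate [Finite V] {G : SimpleGraph V} (hG : G.Connected)
    (hcard : G.edgeSet.ncard = Nat.card V + 1) {a b : V} {c₁ : G.Walk a a} {c₂ : G.Walk b b}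
    (h₁ : c₁.IsCycle) (h₂ : c₂.IsCycle) (hm : MeetOnce c₁ c₂) {x y z : V}
    (hxy : s(x, y) ∈ c₁.edges) (hyz : s(y, z) ∈ c₁.edges) (hzx : s(z, x) ∈ c₁.edges) :
    ∃ κ, IsGate G x y z κ := by
  set H := G.deleteEdges {s(x, y), s(y, z), s(z, x)} with hH
  have nxy : ¬ H.Reachable x y := not_reachable_deleteEdges_triangle hG hcard h₁ h₂ hm hxy hyz hzx
  have nyz : ¬ H.Reachable y z := by
    have := not_reachable_deleteEdges_triangle hG hcard h₁ h₂ hm hyz hzx hxy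
    rwa [show ({s(y, z), s(z, x), s(x, y)} : Set (Sym2 V)) = {s(x, y), s(y, z), s(z, x)} by
      ext; simp; tauto] at this
  have nzx : ¬ H.Reachable z x := by
    have := not_reachable_deleteEdges_triangle hG hcard h₁ h₂ hm hzx hxy hyz
    rwa [show ({s(z, x), s(x, y), s(y, z)} : Set (Sym2 V)) = {s(x, y), s(y, z), s(z, x)} by
      ext; simp; tauto] at this
  have hcross : ∀ p q, G.Adj p q → H.Adj p q ∨
      ((p = x ∨ p = y ∨ p = z) ∧ (q = x ∨ q = y ∨ q = z)) := fun p q hpq => by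
    by_cases hmem : s(p, q) ∈ ({s(x, y), s(y, z), s(z, x)} : Set (Sym2 V))
    · right
      simp only [Set.mem_insert_iff, Set.mem_singleton_iff, Sym2.eq_iff] at hmem
      tauto
    · left
      rw [hH, deleteEdges_adj]
      exact ⟨hpq, hmem⟩
  have hex : ∀ w, ∃ t, (t = x ∨ t = y ∨ t = z) ∧ H.Reachable w t := fun w => by
    obtain ⟨p⟩ := hG.preconnected w x
    by_contra! hno
    obtain ⟨d, -, hd1, hd2⟩ := p.exists_boundary_dart {v | H.Reachable w v} (Reachable.refl w)
      (hno x (by simp))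
    rcases hcross _ _ d.adj with h | ⟨h, -⟩
    · exact hd2 (Reachable.trans hd1 h.reachable)
    · exact hno _ h hd1
  choose κ hκ1 hκ2 using hex
  have huniq : ∀ s t, (s = x ∨ s = y ∨ s = z) → (t = x ∨ t = y ∨ t = z) → H.Reachable s t →
      s = t := by
    have := fun h : H.Reachable y x => nxy h.symm
    have := fun h : H.Reachable z y => nyz h.symm
    have := fun h : H.Reachable x z => nzx h.symm
    rintro s t (rfl | rfl | rfl) (rfl | rfl | rfl) <;> tauto
  have hfix : ∀ s, (s = x ∨ s = y ∨ s = z) → κ s = s := fun s hs =>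
    (huniq _ _ hs (hκ1 s) (hκ2 s)).symm
  refine ⟨κ, c₁.adj_of_mem_edges hxy, c₁.adj_of_mem_edges hyz, c₁.adj_of_mem_edges hzx, hκ1,
    hfix x (by simp), hfix y (by simp), hfix z (by simp), fun p q hpq => ?_⟩
  rcases hcross p q hpq with h | ⟨hp, hq⟩
  · left
    exact huniq _ _ (hκ1 p) (hκ1 q) (((hκ2 p).symm.trans h.reachable).trans (hκ2 q))
  · exact Or.inr ⟨(hfix p hp).symm, (hfix q hq).symm⟩

lemma exists_triangle_of_length_eq_three {G : SimpleGraph V} {a : V} (c : G.Walk a a)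
    (h : c.length = 3) : ∃ x y z, (∀ e, e ∈ c.edges ↔ e = s(x, y) ∨ e = s(y, z) ∨ e = s(z, x)) ∧
      ∀ v, v ∈ c.support ↔ v = x ∨ v = y ∨ v = z := by
  match c, h with
  | .cons (v := p) _ (.cons (v := q) _ (.cons _ .nil)), _ =>
    refine ⟨a, p, q, fun e => by simp, fun v => ?_⟩
    simp
    tauto

/-- The contribution of an edge to the Graovac–Ghorbani index. -/
noncomputable def edgeVal [Fintype V] (G : SimpleGraph V) : Sym2 V → ℝ :=
  Sym2.lift ⟨fun u v => edgeTerm (sideCount G u v) (sideCount G v u), fun _ _ => edgeTerm_comm _ _⟩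

lemma edgeVal_mk [Fintype V] (G : SimpleGraph V) (u v : V) :
    edgeVal G s(u, v) = edgeTerm (sideCount G u v) (sideCount G v u) := rfl

open Classical in
lemma ABCGG_eq_sum [Fintype V] (G : SimpleGraph V) :
    ABCGG G = ∑ e ∈ G.edgeFinset, edgeVal G e := by
  have h1 : ABCGG G = (1 / 2) *
      ∑ p ∈ (Finset.univ : Finset (V × V)) with G.Adj p.1 p.2, edgeVal G s(p.1, p.2) := by
    rw [Finset.sum_filter, Fintype.sum_prod_type]
    rfl
  rw [h1, ← Finset.sum_fiberwise_of_maps_to (t := G.edgeFinset) (g := fun p : V × V => s(p.1, p.2))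
    (fun p hp => by simpa using hp), Finset.mul_sum]
  refine Finset.sum_congr rfl fun e he => ?_
  induction e with
  | _ u v =>
    have hadj : G.Adj u v := by simpa using he
    have h2 : ((Finset.univ.filter fun p : V × V => G.Adj p.1 p.2).filter
        fun p => s(p.1, p.2) = s(u, v)) = {(u, v), (v, u)} := by
      ext ⟨p, q⟩
      simp only [Finset.mem_filter, Finset.mem_univ, true_and, Sym2.eq_iff, Finset.mem_insert,
        Finset.mem_singleton, Prod.mk.injEq]
      refine ⟨fun h => h.2, ?_⟩
      rintro (⟨rfl, rfl⟩ | ⟨rfl, rfl⟩)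
      exacts [⟨hadj, by simp⟩, ⟨hadj.symm, by simp⟩]
    rw [h2, Finset.sum_pair (by simp [hadj.ne]), Sym2.eq_swap (a := v)]
    ring

lemma one_le_sideCount [Fintype V] {G : SimpleGraph V} (hG : G.Connected) {u v : V}
    (h : u ≠ v) : 1 ≤ sideCount G u v := by
  unfold sideCount
  have : Nonempty {w : V // G.dist w u < G.dist w v} :=
    ⟨⟨u, by rw [SimpleGraph.dist_self]; exact hG.pos_dist_of_ne h⟩⟩
  exact Nat.card_pos

lemma sideCount_add_sideCount_le [Fintype V] (G : SimpleGraph V) (u v : V) :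
    sideCount G u v + sideCount G v u ≤ Nat.card V := by
  classical
  unfold sideCount
  simp only [Nat.card_eq_fintype_card, Fintype.card_subtype]
  rw [← Finset.card_union_of_disjoint]
  · exact Finset.card_le_univ _
  · rw [Finset.disjoint_filter]
    intro w _ h
    exact h.le.not_gt

lemma edgeVal_le_pendent [Fintype V] {G : SimpleGraph V} (hG : G.Connected)
    (hn : 2 ≤ Nat.card V) {e : Sym2 V} (he : e ∈ G.edgeSet) :
    edgeVal G e ≤ edgeTerm 1 (Nat.card V - 1) := by
  induction e with
  | _ u v =>
    have hne : u ≠ v := G.ne_of_adj he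
    exact edgeTerm_le_pendent hn (one_le_sideCount hG hne) (one_le_sideCount hG hne.symm)
      (sideCount_add_sideCount_le G u v)

lemma IsGate.sum_edgeVal [Fintype V] {G : SimpleGraph V} {x y z : V} {κ : V → V}
    (hG : G.Connected) (h : IsGate G x y z κ) :
    edgeVal G s(x, y) + edgeVal G s(y, z) + edgeVal G s(z, x) =
      edgeTerm (Nat.card {w // κ w = x}) (Nat.card {w // κ w = y}) +
      edgeTerm (Nat.card {w // κ w = y}) (Nat.card {w // κ w = z}) +
      edgeTerm (Nat.card {w // κ w = z}) (Nat.card {w // κ w = x}) := by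
  simp only [edgeVal_mk]
  rw [h.sideCount_eq hG, h.rotate.sideCount_eq hG, h.rotate.rotate.sideCount_eq hG,
    h.reflect.sideCount_eq hG, h.rotate.reflect.sideCount_eq hG,
    h.rotate.rotate.reflect.sideCount_eq hG]

lemma sum_triangle_edges [DecidableEq V] (f : Sym2 V → ℝ) {x y z : V} (hxy : x ≠ y) (hyz : y ≠ z)
    (hzx : z ≠ x) : ∑ e ∈ ({s(x, y), s(y, z), s(z, x)} : Finset (Sym2 V)), f e =
      f s(x, y) + f s(y, z) + f s(z, x) := by
  rw [Finset.sum_insert, Finset.sum_insert, Finset.sum_singleton, add_assoc]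
  · simp; grind
  · simp; grind

/-- The closed walk `c` runs around a triangle `x y z` whose parts have sizes `1`, `3` and
`n - 4`. -/
structure IsOptimalTriangle {G : SimpleGraph V} {a : V} (c : G.Walk a a) (x y z : V)
    (κ : V → V) : Prop where
  mem_edges : ∀ e, e ∈ c.edges ↔ e = s(x, y) ∨ e = s(y, z) ∨ e = s(z, x)
  mem_support : ∀ v, v ∈ c.support ↔ v = x ∨ v = y ∨ v = z
  isGate : IsGate G x y z κ
  optimal : OptimalParts (Nat.card {w // κ w = x}) (Nat.card {w // κ w = y})
    (Nat.card {w // κ w = z})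

open Classical in
lemma cycle_sum_le [Fintype V] {G : SimpleGraph V} (hG : G.Connected)
    (hcard : G.edgeSet.ncard = Nat.card V + 1) (hn1 : 10 ≤ Nat.card V) (hn2 : Nat.card V ≤ 15)
    {a b : V} {c₁ : G.Walk a a} {c₂ : G.Walk b b} (h₁ : c₁.IsCycle) (h₂ : c₂.IsCycle)
    (hm : MeetOnce c₁ c₂) :
    ∑ e ∈ c₁.edges.toFinset, edgeVal G e ≤ optimalTriangle (Nat.card V) +
        ((c₁.length : ℝ) - 3) * edgeTerm 1 (Nat.card V - 1) ∧
      (∑ e ∈ c₁.edges.toFinset, edgeVal G e = optimalTriangle (Nat.card V) +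
        ((c₁.length : ℝ) - 3) * edgeTerm 1 (Nat.card V - 1) →
        ∃ x y z κ, IsOptimalTriangle c₁ x y z κ) := by
  rcases h₁.three_le_length.eq_or_lt with hlen | hlen
  · obtain ⟨x, y, z, hedges, hsupp⟩ := exists_triangle_of_length_eq_three c₁ hlen.symm
    obtain ⟨κ, hκ⟩ := exists_isGate hG hcard h₁ h₂ hm (x := x) (y := y) (z := z)
      ((hedges _).2 (by simp)) ((hedges _).2 (by simp)) ((hedges _).2 (by simp))
    have hset : c₁.edges.toFinset = {s(x, y), s(y, z), s(z, x)} := by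
      ext e; simp [hedges]
    have hpos : ∀ {t}, κ t = t → 1 ≤ Nat.card {w // κ w = t} := fun {t} ht => by
      have : Nonempty {w // κ w = t} := ⟨⟨t, ht⟩⟩
      exact Nat.card_pos
    rw [hset, sum_triangle_edges _ hκ.xy.ne hκ.yz.ne hκ.zx.ne, hκ.sum_edgeVal hG, ← hlen]
    simp only [Nat.cast_ofNat, sub_self, zero_mul, add_zero]
    by_cases ho : OptimalParts (Nat.card {w // κ w = x}) (Nat.card {w // κ w = y})
        (Nat.card {w // κ w = z})
    · exact ⟨(triangle_eq_optimalTriangle hκ.card_add_card_add_card ho).le,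
        fun _ => ⟨x, y, z, κ, hedges, hsupp, hκ, ho⟩⟩
    · have := triangle_lt_optimalTriangle hn1 hn2 (hpos hκ.fst) (hpos hκ.snd) (hpos hκ.trd)
        hκ.card_add_card_add_card ho
      exact ⟨this.le, fun h => absurd h this.ne⟩
  · have hle : ∑ e ∈ c₁.edges.toFinset, edgeVal G e ≤ c₁.edges.toFinset.card • (0.708 : ℝ) := by
      refine Finset.sum_le_card_nsmul _ _ _ fun e he => ?_
      rw [List.mem_toFinset] at he
      induction e with
      | _ u v =>
        exact edgeTerm_le_of_two_le (two_le_sideCount_of_mem_cycle hG hcard h₁ h₂ hm hlen he)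
          (two_le_sideCount_of_mem_cycle hG hcard h₁ h₂ hm hlen (by rwa [Sym2.eq_swap]))
    rw [List.toFinset_card_of_nodup h₁.isTrail.edges_nodup, Walk.length_edges, nsmul_eq_mul] at hle
    have hl : (4 : ℝ) ≤ c₁.length := by exact_mod_cast hlen
    have hP := le_edgeTerm_pendent hn1
    have hT := le_optimalTriangle hn1
    have hlt : ∑ e ∈ c₁.edges.toFinset, edgeVal G e < optimalTriangle (Nat.card V) +
        ((c₁.length : ℝ) - 3) * edgeTerm 1 (Nat.card V - 1) := by
      nlinarith
    exact ⟨hlt.le, fun h => absurd h hlt.ne⟩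

/-- The value of the index on the extremal graph. -/
noncomputable def extremalValue (n : ℕ) : ℝ :=
  2 * optimalTriangle n + ((n : ℝ) - 5) * edgeTerm 1 (n - 1)

lemma card_eq_one_or_of_edgeVal_eq [Fintype V] {G : SimpleGraph V} (hG : G.Connected)
    (hn : 3 ≤ Nat.card V) {u v : V} (huv : G.Adj u v)
    (h : edgeVal G s(u, v) = edgeTerm 1 (Nat.card V - 1)) :
    sideCount G u v + sideCount G v u = Nat.card V ∧ (sideCount G u v = 1 ∨ sideCount G v u = 1) :=
  parts_of_edgeTerm_eq_pendent hn (one_le_sideCount hG huv.ne) (one_le_sideCount hG huv.ne.symm)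
    (sideCount_add_sideCount_le G u v) h

open Classical in
lemma ABCGG_eq_add_add [Fintype V] (G : SimpleGraph V) {E₁ E₂ : Finset (Sym2 V)}
    (h₁ : E₁ ⊆ G.edgeFinset) (h₂ : E₂ ⊆ G.edgeFinset) (hd : Disjoint E₁ E₂) :
    ABCGG G = ∑ e ∈ E₁, edgeVal G e + ∑ e ∈ E₂, edgeVal G e +
      ∑ e ∈ G.edgeFinset \ (E₁ ∪ E₂), edgeVal G e := by
  rw [ABCGG_eq_sum, ← Finset.sum_union hd, add_comm, Finset.sum_sdiff (Finset.union_subset h₁ h₂)]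

open Classical in
lemma ABCGG_le [Fintype V] {G : SimpleGraph V} (hG : G.Connected)
    (hcard : G.edgeSet.ncard = Nat.card V + 1) (hn1 : 10 ≤ Nat.card V) (hn2 : Nat.card V ≤ 15)
    {a b : V} {c₁ : G.Walk a a} {c₂ : G.Walk b b} (h₁ : c₁.IsCycle) (h₂ : c₂.IsCycle)
    (hm : MeetOnce c₁ c₂) :
    ABCGG G ≤ extremalValue (Nat.card V) ∧
      (ABCGG G = extremalValue (Nat.card V) →
        (∃ x y z κ, IsOptimalTriangle c₁ x y z κ) ∧
        (∃ x y z κ, IsOptimalTriangle c₂ x y z κ) ∧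
        ∀ u v, G.Adj u v → s(u, v) ∉ c₁.edges → s(u, v) ∉ c₂.edges →
          sideCount G u v + sideCount G v u = Nat.card V ∧
            (sideCount G u v = 1 ∨ sideCount G v u = 1)) := by
  have hd : Disjoint c₁.edges.toFinset c₂.edges.toFinset := by
    rw [Finset.disjoint_left]
    intro e h h'
    exact hm.disjoint_edges (List.mem_toFinset.1 h) (List.mem_toFinset.1 h')
  have hs : ∀ {a : V} (c : G.Walk a a), c.edges.toFinset ⊆ G.edgeFinset := fun c e he => by
    rw [mem_edgeFinset]; exact c.edges_subset_edgeSet (List.mem_toFinset.1 he)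
  have hcd : ∀ {a : V} {c : G.Walk a a}, c.IsCycle → c.edges.toFinset.card = c.length :=
    fun hc => by rw [List.toFinset_card_of_nodup hc.isTrail.edges_nodup, Walk.length_edges]
  have hsplit := ABCGG_eq_add_add G (hs c₁) (hs c₂) hd
  set E := G.edgeFinset \ (c₁.edges.toFinset ∪ c₂.edges.toFinset) with hE
  have hadd : E.card + (c₁.length + c₂.length) = Nat.card V + 1 := by
    rw [hE, ← hcd h₁, ← hcd h₂, ← Finset.card_union_of_disjoint hd,
      Finset.card_sdiff_add_card_eq_card (Finset.union_subset (hs c₁) (hs c₂)), ← hcard,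
      ← coe_edgeFinset, Set.ncard_coe_finset]
  have haddR : (E.card : ℝ) + (c₁.length + c₂.length) = Nat.card V + 1 := by exact_mod_cast hadd
  obtain ⟨hle₁, heq₁⟩ := cycle_sum_le hG hcard hn1 hn2 h₁ h₂ hm
  obtain ⟨hle₂, heq₂⟩ := cycle_sum_le hG hcard hn1 hn2 h₂ h₁ hm.symm
  have hterm : ∀ e ∈ E, edgeVal G e ≤ edgeTerm 1 (Nat.card V - 1) := fun e he =>
    edgeVal_le_pendent hG (by omega) (mem_edgeFinset.1 (Finset.mem_sdiff.1 he).1)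
  have hconst : ∑ _e ∈ E, edgeTerm 1 (Nat.card V - 1) =
      ((Nat.card V : ℝ) + 1 - c₁.length - c₂.length) * edgeTerm 1 (Nat.card V - 1) := by
    rw [Finset.sum_const, nsmul_eq_mul]
    congr 1
    linarith
  have hle₃ := Finset.sum_le_sum hterm
  unfold extremalValue
  refine ⟨by linarith, fun heq => ⟨heq₁ (by linarith), heq₂ (by linarith), fun u v huv hn₁ hn₂ =>
    card_eq_one_or_of_edgeVal_eq hG (by omega) huv ?_⟩⟩
  exact (Finset.sum_eq_sum_iff_of_le hterm).1 (by linarith) _ (by simp [hE, huv, hn₁, hn₂])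

lemma IsGate.apply_of_notMem {G : SimpleGraph V} {x y z : V} {κ : V → V}
    (h : IsGate G x y z κ) {v w : V} (hvw : G.Adj v w) (hv : v ≠ x ∧ v ≠ y ∧ v ≠ z) :
    κ v = κ w := by
  rcases h.adj v w hvw with h1 | ⟨h1, -⟩
  · exact h1
  · have := h.mem v
    rw [← h1] at this
    tauto

/-- The vertex `v` is pendent, with `w` as its only neighbour. -/
def IsLeafAt (G : SimpleGraph V) (v w : V) : Prop :=
  G.Adj v w ∧ ∀ s, G.Adj v s → s = w

lemma exists_adj_dist_eq_succ {G : SimpleGraph V} (hG : G.Connected) {v u : V} (h : v ≠ u) :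
    ∃ w, G.Adj v w ∧ G.dist v u = G.dist w u + 1 := by
  obtain ⟨p, hp⟩ := hG.exists_walk_length_eq_dist v u
  cases p with
  | nil => exact absurd rfl h
  | @cons _ w _ hadj p =>
    refine ⟨w, hadj, le_antisymm ?_ ?_⟩
    · have h1 := hG.dist_triangle (u := v) (v := w) (w := u)
      rw [dist_eq_one_iff_adj.2 hadj] at h1
      omega
    · rw [← hp, Walk.length_cons]
      exact Nat.succ_le_succ (dist_le p)

lemma sideCount_set_univ [Fintype V] {G : SimpleGraph V} {u v : V}
    (h : sideCount G u v + sideCount G v u = Nat.card V) (w : V) :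
    G.dist w u < G.dist w v ∨ G.dist w v < G.dist w u := by
  classical
  unfold sideCount at h
  simp only [Nat.card_eq_fintype_card, Fintype.card_subtype] at h
  rw [← Finset.card_union_of_disjoint] at h
  · have h1 := Finset.eq_univ_of_card _ h
    simpa using Finset.eq_univ_iff_forall.1 h1 w
  · rw [Finset.disjoint_filter]
    intro w _ h
    exact h.le.not_gt

lemma isLeafAt_of_sideCount_eq_one [Fintype V] {G : SimpleGraph V} (hG : G.Connected) {u v : V}
    (huv : G.Adj u v) (h : sideCount G u v + sideCount G v u = Nat.card V)
    (h1 : sideCount G u v = 1) : IsLeafAt G u v := by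
  refine ⟨huv, fun s hs => ?_⟩
  rcases sideCount_set_univ h s with h2 | h2
  · exfalso
    unfold sideCount at h1
    have h3 : G.dist u u < G.dist u v := by
      rw [SimpleGraph.dist_self]; exact hG.pos_dist_of_ne huv.ne
    have := (Nat.card_eq_one_iff_unique.1 h1).1.elim ⟨u, h3⟩ ⟨s, h2⟩
    exact hs.ne (congrArg Subtype.val this)
  · rw [dist_eq_one_iff_adj.2 hs.symm, Nat.lt_one_iff] at h2
    exact hG.dist_eq_zero_iff.1 h2

lemma IsLeafAt.edgeVal_eq [Fintype V] {G : SimpleGraph V} (hG : G.Connected) {u v : V}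
    (h : IsLeafAt G u v) : edgeVal G s(u, v) = edgeTerm 1 (Nat.card V - 1) := by
  classical
  have hlt : ∀ w, w ≠ u → G.dist w v < G.dist w u := fun w hw => by
    obtain ⟨t, ht, hd⟩ := exists_adj_dist_eq_succ hG hw.symm
    rw [h.2 t ht] at hd
    rw [SimpleGraph.dist_comm, SimpleGraph.dist_comm (u := w)]
    omega
  have hu : G.dist u u < G.dist u v := by
    rw [SimpleGraph.dist_self]; exact hG.pos_dist_of_ne h.1.ne
  have h1 : sideCount G u v = 1 := by
    unfold sideCount
    rw [Nat.card_congr (Equiv.subtypeEquivRight (q := fun w => w = u) fun w => ?_)]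
    · simp
    · refine ⟨fun hw => ?_, fun hw => hw ▸ hu⟩
      by_contra hne
      exact hw.not_gt (hlt w hne)
  have h2 : sideCount G v u = Nat.card V - 1 := by
    unfold sideCount
    rw [Nat.card_congr (Equiv.subtypeEquivRight (q := fun w => w ≠ u) fun w => ?_)]
    · simp [Nat.card_eq_fintype_card, Fintype.card_subtype_compl]
    · exact ⟨fun hw => by rintro rfl; exact hw.not_gt hu, hlt w⟩
  rw [edgeVal_mk, h1, h2]

/-- Outside the two triangles `ι 0, ι 1, ι 2` and `ι 0, ι 3, ι 4` every edge is pendent. -/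
structure IsPendentButterfly (G : SimpleGraph V) (ι : Fin 5 → V) (κ₁ κ₂ : V → V) : Prop where
  connected : G.Connected
  injective : Function.Injective ι
  fst : IsGate G (ι 0) (ι 1) (ι 2) κ₁
  snd : IsGate G (ι 0) (ι 3) (ι 4) κ₂
  pendent : ∀ v w, G.Adj v w →
    s(v, w) = s(ι 0, ι 1) ∨ s(v, w) = s(ι 1, ι 2) ∨ s(v, w) = s(ι 2, ι 0) ∨
    s(v, w) = s(ι 0, ι 3) ∨ s(v, w) = s(ι 3, ι 4) ∨ s(v, w) = s(ι 4, ι 0) ∨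
    IsLeafAt G v w ∨ IsLeafAt G w v

namespace IsPendentButterfly

variable {G : SimpleGraph V} {ι : Fin 5 → V} {κ₁ κ₂ : V → V}

lemma not_isLeafAt (h : IsPendentButterfly G ι κ₁ κ₂) (i : Fin 5) (w : V) :
    ¬ IsLeafAt G (ι i) w := by
  rintro ⟨-, hw⟩
  have h1 := h.fst.xy; have h2 := h.fst.yz; have h3 := h.fst.zx
  have h4 := h.snd.xy; have h5 := h.snd.yz; have h6 := h.snd.zx
  fin_cases i
  · exact h2.ne ((hw _ h1).trans (hw _ h3.symm).symm)
  · exact h3.ne ((hw _ h2).trans (hw _ h1.symm).symm)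
  · exact h1.ne ((hw _ h3).trans (hw _ h2.symm).symm)
  · exact h6.ne ((hw _ h5).trans (hw _ h4.symm).symm)
  · exact h4.ne ((hw _ h6).trans (hw _ h5.symm).symm)

lemma isLeafAt_or (h : IsPendentButterfly G ι κ₁ κ₂) {v w : V} (hv : v ∉ Set.range ι)
    (hvw : G.Adj v w) : IsLeafAt G v w ∨ IsLeafAt G w v := by
  have hne : ∀ i, v ≠ ι i := fun i hi => hv ⟨i, hi.symm⟩
  have := h.pendent v w hvw
  simpa [Sym2.eq_iff, hne] using this

lemma step (h : IsPendentButterfly G ι κ₁ κ₂) {v : V} (hv : v ∉ Set.range ι) :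
    ∃ w, IsLeafAt G v w ∧ G.dist v (ι 0) = G.dist w (ι 0) + 1 := by
  obtain ⟨w, hvw, hd⟩ := exists_adj_dist_eq_succ h.connected (fun h' => hv ⟨0, h'.symm⟩ : v ≠ ι 0)
  refine ⟨w, (h.isLeafAt_or hv hvw).resolve_right fun hl => ?_, hd⟩
  obtain ⟨t, ht, hd'⟩ := exists_adj_dist_eq_succ h.connected
    (fun h' => h.not_isLeafAt 0 v (h' ▸ hl) : w ≠ ι 0)
  rw [hl.2 t ht] at hd'
  omega

lemma exists_isLeafAt (h : IsPendentButterfly G ι κ₁ κ₂) {v : V} (hv : v ∉ Set.range ι) :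
    ∃ i, IsLeafAt G v (ι i) := by
  obtain ⟨w, hw, hd⟩ := h.step hv
  by_cases hr : w ∈ Set.range ι
  · obtain ⟨i, rfl⟩ := hr
    exact ⟨i, hw⟩
  · obtain ⟨t, ht, hd'⟩ := h.step hr
    rw [← ht.2 v hw.1.symm] at hd'
    omega

lemma card_fiber [Finite V] (h : IsPendentButterfly G ι κ₁ κ₂) :
    Nat.card V = 5 + Nat.card {w // IsLeafAt G w (ι 0)} + Nat.card {w // IsLeafAt G w (ι 1)} +
      Nat.card {w // IsLeafAt G w (ι 2)} + Nat.card {w // IsLeafAt G w (ι 3)} +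
      Nat.card {w // IsLeafAt G w (ι 4)} := by
  have e : Fin 5 ⊕ (Σ i : Fin 5, {w // IsLeafAt G w (ι i)}) ≃ V := by
    refine Equiv.ofBijective (Sum.elim ι fun p => p.2.1) ⟨?_, fun v => ?_⟩
    · rintro (i | ⟨i, w, hw⟩) (j | ⟨j, t, ht⟩) heq
      · exact congrArg _ (h.injective heq)
      · obtain rfl : ι i = t := heq
        exact absurd ht (h.not_isLeafAt i _)
      · obtain rfl : w = ι j := heq
        exact absurd hw (h.not_isLeafAt j _)
      · obtain rfl : w = t := heq
        obtain rfl : i = j := h.injective (ht.2 _ hw.1)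
        rfl
    · by_cases hv : v ∈ Set.range ι
      · obtain ⟨i, rfl⟩ := hv
        exact ⟨Sum.inl i, rfl⟩
      · obtain ⟨i, hi⟩ := h.exists_isLeafAt hv
        exact ⟨Sum.inr ⟨i, v, hi⟩, rfl⟩
  rw [← Nat.card_congr e, Nat.card_sum, Nat.card_sigma, Fin.sum_univ_five]
  simp
  ring

lemma card_part [Finite V] (h : IsPendentButterfly G ι κ₁ κ₂) {κ : V → V} {x y z : V}
    (hκ : IsGate G x y z κ) (hx : ∃ i, x = ι i) (hy : ∃ i, y = ι i) (hz : ∃ i, z = ι i) {i : Fin 5}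
    (hi : ∀ j, κ (ι j) = ι i ↔ j = i) :
    Nat.card {w // κ w = ι i} = Nat.card {w // IsLeafAt G w (ι i)} + 1 := by
  have e : Option {w // IsLeafAt G w (ι i)} ≃ {w // κ w = ι i} := by
    have hleaf : ∀ w j, IsLeafAt G w (ι j) → κ w = κ (ι j) := fun w j hw =>
      hκ.apply_of_notMem hw.1 (by
        have : ∀ j, w ≠ ι j := fun j hj => h.not_isLeafAt j _ (hj ▸ hw)
        obtain ⟨_, rfl⟩ := hx
        obtain ⟨_, rfl⟩ := hy
        obtain ⟨_, rfl⟩ := hz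
        exact ⟨this _, this _, this _⟩)
    refine Equiv.ofBijective (fun o => o.elim ⟨ι i, (hi i).2 rfl⟩
      fun w => ⟨w.1, (hleaf _ _ w.2).trans ((hi i).2 rfl)⟩) ⟨?_, fun ⟨w, hw⟩ => ?_⟩
    · rintro (_ | ⟨w, hw⟩) (_ | ⟨t, ht⟩) heq
      · rfl
      · obtain rfl : ι i = t := congrArg Subtype.val heq
        exact absurd ht (h.not_isLeafAt i _)
      · obtain rfl : w = ι i := congrArg Subtype.val heq
        exact absurd hw (h.not_isLeafAt i _)
      · have : w = t := congrArg Subtype.val heq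
        subst this; rfl
    · by_cases hv : w ∈ Set.range ι
      · obtain ⟨j, rfl⟩ := hv
        obtain rfl := (hi j).1 hw
        exact ⟨none, rfl⟩
      · obtain ⟨j, hj⟩ := h.exists_isLeafAt hv
        obtain rfl := (hi j).1 ((hleaf w j hj).symm.trans hw)
        exact ⟨some ⟨w, hj⟩, rfl⟩
  rw [← Nat.card_congr e, Finite.card_option]

lemma cards [Finite V] (h : IsPendentButterfly G ι κ₁ κ₂) :
    (Nat.card {w // κ₁ w = ι 1} = Nat.card {w // IsLeafAt G w (ι 1)} + 1 ∧
      Nat.card {w // κ₁ w = ι 2} = Nat.card {w // IsLeafAt G w (ι 2)} + 1) ∧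
    (Nat.card {w // κ₂ w = ι 3} = Nat.card {w // IsLeafAt G w (ι 3)} + 1 ∧
      Nat.card {w // κ₂ w = ι 4} = Nat.card {w // IsLeafAt G w (ι 4)} + 1) := by
  have a0 := h.fst.fst; have a1 := h.fst.snd; have a2 := h.fst.trd
  have b0 := h.snd.fst; have b3 := h.snd.snd; have b4 := h.snd.trd
  have hne : ∀ {i j}, i ≠ j → ι i ≠ ι j := fun hij h' => hij (h.injective h')
  have a3 : κ₁ (ι 3) = ι 0 := a0 ▸ h.fst.apply_of_notMem h.snd.xy.symm
    ⟨hne (by decide), hne (by decide), hne (by decide)⟩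
  have a4 : κ₁ (ι 4) = ι 0 := a0 ▸ h.fst.apply_of_notMem h.snd.zx
    ⟨hne (by decide), hne (by decide), hne (by decide)⟩
  have b1 : κ₂ (ι 1) = ι 0 := b0 ▸ h.snd.apply_of_notMem h.fst.xy.symm
    ⟨hne (by decide), hne (by decide), hne (by decide)⟩
  have b2 : κ₂ (ι 2) = ι 0 := b0 ▸ h.snd.apply_of_notMem h.fst.zx
    ⟨hne (by decide), hne (by decide), hne (by decide)⟩
  refine ⟨⟨?_, ?_⟩, ?_, ?_⟩
  · refine h.card_part h.fst ⟨_, rfl⟩ ⟨_, rfl⟩ ⟨_, rfl⟩ fun j => ?_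
    fin_cases j <;> simp [a0, a1, a2, a3, a4, h.injective.eq_iff]
  · refine h.card_part h.fst ⟨_, rfl⟩ ⟨_, rfl⟩ ⟨_, rfl⟩ fun j => ?_
    fin_cases j <;> simp [a0, a1, a2, a3, a4, h.injective.eq_iff]
  · refine h.card_part h.snd ⟨_, rfl⟩ ⟨_, rfl⟩ ⟨_, rfl⟩ fun j => ?_
    fin_cases j <;> simp [b0, b1, b2, b3, b4, h.injective.eq_iff]
  · refine h.card_part h.snd ⟨_, rfl⟩ ⟨_, rfl⟩ ⟨_, rfl⟩ fun j => ?_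
    fin_cases j <;> simp [b0, b1, b2, b3, b4, h.injective.eq_iff]

lemma leaf_cards [Finite V] (h : IsPendentButterfly G ι κ₁ κ₂) (hn : 10 ≤ Nat.card V)
    (h₁ : OptimalParts (Nat.card {w // κ₁ w = ι 0}) (Nat.card {w // κ₁ w = ι 1})
      (Nat.card {w // κ₁ w = ι 2}))
    (h₂ : OptimalParts (Nat.card {w // κ₂ w = ι 0}) (Nat.card {w // κ₂ w = ι 3})
      (Nat.card {w // κ₂ w = ι 4}))
    (hle₁ : Nat.card {w // κ₁ w = ι 2} ≤ Nat.card {w // κ₁ w = ι 1})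
    (hle₂ : Nat.card {w // κ₂ w = ι 4} ≤ Nat.card {w // κ₂ w = ι 3}) :
    Nat.card {w // IsLeafAt G w (ι 0)} = Nat.card V - 9 ∧
    Nat.card {w // IsLeafAt G w (ι 1)} = 2 ∧ Nat.card {w // IsLeafAt G w (ι 2)} = 0 ∧
    Nat.card {w // IsLeafAt G w (ι 3)} = 2 ∧ Nat.card {w // IsLeafAt G w (ι 4)} = 0 := by
  have := Fintype.ofFinite V
  have c1 := h.fst.card_add_card_add_card
  have c2 := h.snd.card_add_card_add_card
  have c3 := h.card_fiber
  obtain ⟨⟨c4, c5⟩, c6, c7⟩ := h.cards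
  unfold OptimalParts at h₁ h₂
  omega

lemma nonempty_iso [Finite V] (h : IsPendentButterfly G ι κ₁ κ₂) {m : ℕ}
    (h0 : Nat.card {w // IsLeafAt G w (ι 0)} = m)
    (h1 : Nat.card {w // IsLeafAt G w (ι 1)} = 2) (h2 : Nat.card {w // IsLeafAt G w (ι 2)} = 0)
    (h3 : Nat.card {w // IsLeafAt G w (ι 3)} = 2) (h4 : Nat.card {w // IsLeafAt G w (ι 4)} = 0) :
    Nonempty (G ≃g S33 2 0 2 0 m) := by
  have := Fintype.ofFinite V
  have hcard := h.card_fiber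
  let e0 := (Finite.equivFinOfCardEq h0).symm
  let e1 := (Finite.equivFinOfCardEq h1).symm
  let e3 := (Finite.equivFinOfCardEq h3).symm
  have h2' := Finite.card_eq_zero_iff.1 h2
  have h4' := Finite.card_eq_zero_iff.1 h4
  let f : SVert 2 0 2 0 m → V := Sum.elim ι (Sum.elim (fun i => (e1 i).1) (Sum.elim Fin.elim0
    (Sum.elim (fun i => (e3 i).1) (Sum.elim Fin.elim0 fun i => (e0 i).1))))
  have hleaf : ∀ v i, IsLeafAt G v (ι i) →
      ∃ x, f x = v ∧ (S33 2 0 2 0 m).Adj x (Sum.inl i) := fun v i hv => by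
    fin_cases i
    · exact ⟨Sum.inr (Sum.inr (Sum.inr (Sum.inr (Sum.inr (e0.symm ⟨v, hv⟩))))), by simp [f],
        by simp [S33]⟩
    · exact ⟨Sum.inr (Sum.inl (e1.symm ⟨v, hv⟩)), by simp [f], by simp [S33, -Fin.exists_fin_two]⟩
    · exact (h2'.false ⟨v, hv⟩).elim
    · exact ⟨Sum.inr (Sum.inr (Sum.inr (Sum.inl (e3.symm ⟨v, hv⟩)))), by simp [f],
        by simp [S33, -Fin.exists_fin_two]⟩
    · exact (h4'.false ⟨v, hv⟩).elim
  have hsurj : Function.Surjective f := fun v => by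
    by_cases hv : v ∈ Set.range ι
    · obtain ⟨i, rfl⟩ := hv
      exact ⟨Sum.inl i, rfl⟩
    · obtain ⟨i, hi⟩ := h.exists_isLeafAt hv
      obtain ⟨x, hx, -⟩ := hleaf v i hi
      exact ⟨x, hx⟩
  have hbij : Function.Bijective f := by
    rw [Fintype.bijective_iff_surjective_and_card]
    refine ⟨hsurj, ?_⟩
    rw [← Nat.card_eq_fintype_card (α := V), hcard]
    simp
    omega
  have hom : ∀ x y, (S33 2 0 2 0 m).Adj x y → G.Adj (f x) (f y) := by
    intro x y hxy
    rw [S33, fromRel_adj] at hxy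
    rcases hxy.2 with hxy | hxy
    on_goal 2 => refine Adj.symm ?_
    all_goals
      rcases hxy with ⟨rfl, rfl⟩ | ⟨rfl, rfl⟩ | ⟨rfl, rfl⟩ | ⟨rfl, rfl⟩ | ⟨rfl, rfl⟩ |
        ⟨rfl, rfl⟩ | ⟨i, rfl, rfl⟩ | ⟨i, rfl, rfl⟩ | ⟨i, rfl, rfl⟩ | ⟨i, rfl, rfl⟩ | ⟨i, rfl, rfl⟩
      exacts [h.fst.xy, h.fst.yz, h.fst.zx, h.snd.xy, h.snd.yz, h.snd.zx, (e1 i).2.1.symm,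
        i.elim0, (e3 i).2.1.symm, i.elim0, (e0 i).2.1.symm]
  have hinv : ∀ v w, G.Adj v w → ∃ x y, f x = v ∧ f y = w ∧ (S33 2 0 2 0 m).Adj x y := by
    intro v w hvw
    have hsub : ∀ w v, IsLeafAt G v w → ∃ x y, f x = v ∧ f y = w ∧ (S33 2 0 2 0 m).Adj x y := by
      intro w v hl
      have hv : v ∉ Set.range ι := by
        rintro ⟨i, rfl⟩
        exact h.not_isLeafAt i _ hl
      obtain ⟨i, hi⟩ := h.exists_isLeafAt hv
      obtain rfl := hl.2 _ hi.1
      obtain ⟨x, hx, hadj⟩ := hleaf v i hi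
      exact ⟨x, Sum.inl i, hx, rfl, hadj⟩
    have hedge : ∀ i j, (S33 2 0 2 0 m).Adj (Sum.inl i) (Sum.inl j) → s(v, w) = s(ι i, ι j) →
        ∃ x y, f x = v ∧ f y = w ∧ (S33 2 0 2 0 m).Adj x y := by
      intro i j hij heq
      rcases Sym2.eq_iff.1 heq with ⟨rfl, rfl⟩ | ⟨rfl, rfl⟩
      exacts [⟨_, _, rfl, rfl, hij⟩, ⟨_, _, rfl, rfl, hij.symm⟩]
    rcases h.pendent v w hvw with h' | h' | h' | h' | h' | h' | h' | h'
    · exact hedge _ _ (by simp [S33]) h'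
    · exact hedge _ _ (by simp [S33]) h'
    · exact hedge _ _ (by simp [S33]) h'
    · exact hedge _ _ (by simp [S33]) h'
    · exact hedge _ _ (by simp [S33]) h'
    · exact hedge _ _ (by simp [S33]) h'
    · exact hsub _ _ h'
    · obtain ⟨x, y, hx, hy, hxy⟩ := hsub _ _ h'
      exact ⟨y, x, hy, hx, hxy.symm⟩
  refine ⟨(⟨Equiv.ofBijective f hbij, fun {x y} => ⟨fun hxy => ?_, hom x y⟩⟩ :
    S33 2 0 2 0 m ≃g G).symm⟩
  obtain ⟨x', y', hx, hy, hadj⟩ := hinv _ _ hxy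
  rwa [← hbij.1 hx, ← hbij.1 hy]

end IsPendentButterfly

lemma Iso.dist_map_le {W : Type*} {G : SimpleGraph V} {H : SimpleGraph W} (f : G ≃g H)
    (hG : G.Connected) (u v : V) : H.dist (f u) (f v) ≤ G.dist u v := by
  obtain ⟨p, hp⟩ := hG.exists_walk_length_eq_dist u v
  rw [← hp, ← Walk.length_map f.toHom]
  exact dist_le _

lemma Iso.dist_map_eq {W : Type*} {G : SimpleGraph V} {H : SimpleGraph W} (f : G ≃g H)
    (hG : G.Connected) (u v : V) : H.dist (f u) (f v) = G.dist u v := by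
  refine le_antisymm (Iso.dist_map_le f hG u v) ?_
  simpa using Iso.dist_map_le f.symm (f.connected_iff.1 hG) (f u) (f v)

lemma Iso.sideCount_eq {W : Type*} [Fintype V] [Fintype W] {G : SimpleGraph V}
    {H : SimpleGraph W} (f : G ≃g H) (hG : G.Connected) (u v : V) :
    sideCount H (f u) (f v) = sideCount G u v :=
  (Nat.card_congr (f.toEquiv.subtypeEquiv fun w => by
    simp [Iso.dist_map_eq f hG])).symm

open Classical in
lemma Iso.ABCGG_eq {W : Type*} [Fintype V] [Fintype W] {G : SimpleGraph V}
    {H : SimpleGraph W} (f : G ≃g H) (hG : G.Connected) : ABCGG H = ABCGG G := by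
  unfold ABCGG
  rw [← f.toEquiv.sum_comp]
  congr 1
  refine Finset.sum_congr rfl fun u _ => ?_
  rw [← f.toEquiv.sum_comp]
  refine Finset.sum_congr rfl fun v _ => if_congr f.map_adj_iff ?_ rfl
  rw [RelIso.coe_fn_toEquiv, Iso.sideCount_eq f hG, Iso.sideCount_eq f hG]

lemma Iso.ncard_edgeSet_eq {W : Type*} {G : SimpleGraph V} {H : SimpleGraph W} (f : G ≃g H) :
    H.edgeSet.ncard = G.edgeSet.ncard :=
  (Nat.card_congr f.mapEdgeSet).symm

open Classical in
lemma IsPendentButterfly.ABCGG_eq [Fintype V] {G : SimpleGraph V} {ι : Fin 5 → V}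
    {κ₁ κ₂ : V → V} (h : IsPendentButterfly G ι κ₁ κ₂)
    (hcard : G.edgeSet.ncard = Nat.card V + 1)
    (h₁ : OptimalParts (Nat.card {w // κ₁ w = ι 0}) (Nat.card {w // κ₁ w = ι 1})
      (Nat.card {w // κ₁ w = ι 2}))
    (h₂ : OptimalParts (Nat.card {w // κ₂ w = ι 0}) (Nat.card {w // κ₂ w = ι 3})
      (Nat.card {w // κ₂ w = ι 4})) :
    ABCGG G = extremalValue (Nat.card V) := by
  have hsub : ∀ {x y z κ}, IsGate G x y z κ →
      ({s(x, y), s(y, z), s(z, x)} : Finset (Sym2 V)) ⊆ G.edgeFinset := fun hg => by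
    simp [Finset.insert_subset_iff, hg.xy, hg.yz, hg.zx]
  have hthree : ∀ {x y z κ}, IsGate G x y z κ →
      ({s(x, y), s(y, z), s(z, x)} : Finset (Sym2 V)).card = 3 := fun hg => by
    rw [Finset.card_eq_three]
    refine ⟨_, _, _, ?_, ?_, ?_, rfl⟩ <;>
      simp [hg.xy.ne, hg.yz.ne, hg.zx.ne, hg.xy.ne.symm, hg.zx.ne.symm]
  have hd : Disjoint ({s(ι 0, ι 1), s(ι 1, ι 2), s(ι 2, ι 0)} : Finset (Sym2 V))
      {s(ι 0, ι 3), s(ι 3, ι 4), s(ι 4, ι 0)} := by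
    simp [h.injective.eq_iff]
  have hE : G.edgeFinset.card = Nat.card V + 1 := by
    rw [← Set.ncard_coe_finset, coe_edgeFinset, hcard]
  rw [ABCGG_eq_add_add G (hsub h.fst) (hsub h.snd) hd,
    sum_triangle_edges _ h.fst.xy.ne h.fst.yz.ne h.fst.zx.ne,
    sum_triangle_edges _ h.snd.xy.ne h.snd.yz.ne h.snd.zx.ne,
    h.fst.sum_edgeVal h.connected, h.snd.sum_edgeVal h.connected,
    triangle_eq_optimalTriangle h.fst.card_add_card_add_card h₁,
    triangle_eq_optimalTriangle h.snd.card_add_card_add_card h₂,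
    Finset.sum_eq_card_nsmul (b := edgeTerm 1 (Nat.card V - 1)), nsmul_eq_mul]
  · have hu := Finset.card_sdiff_add_card_eq_card
      (Finset.union_subset (hsub h.fst) (hsub h.snd))
    rw [Finset.card_union_of_disjoint hd, hthree h.fst, hthree h.snd, hE] at hu
    have hu' := congrArg (Nat.cast (R := ℝ)) hu
    push_cast at hu'
    rw [eq_sub_of_add_eq hu', extremalValue]
    ring
  · intro e he
    induction e with
    | _ v w =>
      simp only [Finset.mem_sdiff, mem_edgeFinset, mem_edgeSet, Finset.mem_union,
        Finset.mem_insert, Finset.mem_singleton, not_or] at he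
      obtain ⟨he, ⟨e1, e2, e3⟩, e4, e5, e6⟩ := he
      have := h.pendent v w he
      simp only [e1, e2, e3, e4, e5, e6, false_or] at this
      rcases this with hl | hl
      · exact hl.edgeVal_eq h.connected
      · rw [Sym2.eq_swap]; exact hl.edgeVal_eq h.connected

lemma exists_isPendentButterfly_S33 {m : ℕ} (hc : (S33 2 0 2 0 m).Connected) :
    ∃ κ₁ κ₂, IsPendentButterfly (S33 2 0 2 0 m) Sum.inl κ₁ κ₂ ∧
      (Nat.card {w // κ₁ w = Sum.inl 1} = 3 ∧ Nat.card {w // κ₁ w = Sum.inl 2} = 1) ∧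
      (Nat.card {w // κ₂ w = Sum.inl 3} = 3 ∧ Nat.card {w // κ₂ w = Sum.inl 4} = 1) := by
  refine ⟨Sum.elim (fun i => Sum.inl (![0, 1, 2, 0, 0] i))
      (Sum.elim (fun _ => Sum.inl 1) fun _ => Sum.inl 0),
    Sum.elim (fun i => Sum.inl (![0, 0, 0, 3, 4] i)) (Sum.elim (fun _ => Sum.inl 0)
      (Sum.elim (fun _ => Sum.inl 0) (Sum.elim (fun _ => Sum.inl 3) fun _ => Sum.inl 0))),
    ⟨hc, Sum.inl_injective, ⟨?_, ?_, ?_, ?_, rfl, rfl, rfl, ?_⟩,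
      ⟨?_, ?_, ?_, ?_, rfl, rfl, rfl, ?_⟩, ?_⟩, ?_⟩
  · simp [S33]
  · simp [S33]
  · simp [S33]
  · rintro (i | i | i)
    · fin_cases i <;> simp
    · simp
    · simp
  · intro p q hpq
    rw [S33, fromRel_adj] at hpq
    rcases hpq with ⟨-, hpq | hpq⟩
    all_goals
      rcases hpq with ⟨rfl, rfl⟩ | ⟨rfl, rfl⟩ | ⟨rfl, rfl⟩ | ⟨rfl, rfl⟩ | ⟨rfl, rfl⟩ |
        ⟨rfl, rfl⟩ | ⟨i, rfl, rfl⟩ | ⟨i, rfl, rfl⟩ | ⟨i, rfl, rfl⟩ | ⟨i, rfl, rfl⟩ |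
        ⟨i, rfl, rfl⟩ <;> first | exact i.elim0 | simp
  · simp [S33]
  · simp [S33]
  · simp [S33]
  · rintro (i | i | i | i | i)
    · fin_cases i <;> simp
    all_goals simp
  · intro p q hpq
    rw [S33, fromRel_adj] at hpq
    rcases hpq with ⟨-, hpq | hpq⟩
    all_goals
      rcases hpq with ⟨rfl, rfl⟩ | ⟨rfl, rfl⟩ | ⟨rfl, rfl⟩ | ⟨rfl, rfl⟩ | ⟨rfl, rfl⟩ |
        ⟨rfl, rfl⟩ | ⟨i, rfl, rfl⟩ | ⟨i, rfl, rfl⟩ | ⟨i, rfl, rfl⟩ | ⟨i, rfl, rfl⟩ |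
        ⟨i, rfl, rfl⟩ <;> first | exact i.elim0 | simp
  · have hleaf : ∀ x i, (S33 2 0 2 0 m).Adj (Sum.inr x) (Sum.inl i) →
        IsLeafAt (S33 2 0 2 0 m) (Sum.inr x) (Sum.inl i) := fun x i hx => by
      refine ⟨hx, fun s hs => ?_⟩
      rcases x with x | x | x | x | x <;> first
        | exact x.elim0
        | (simp [S33, -Fin.exists_fin_two] at hx hs; rw [hx, hs.2])
    intro p q hpq
    have hpq' := hpq
    rw [S33, fromRel_adj] at hpq'
    rcases hpq' with ⟨-, hpq' | hpq'⟩
    all_goals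
      rcases hpq' with ⟨rfl, rfl⟩ | ⟨rfl, rfl⟩ | ⟨rfl, rfl⟩ | ⟨rfl, rfl⟩ | ⟨rfl, rfl⟩ |
        ⟨rfl, rfl⟩ | ⟨i, rfl, rfl⟩ | ⟨i, rfl, rfl⟩ | ⟨i, rfl, rfl⟩ | ⟨i, rfl, rfl⟩ |
        ⟨i, rfl, rfl⟩ <;> first | simp [hleaf _ _ hpq] | simp [hleaf _ _ hpq.symm] | simp
  · simp only [Nat.card_eq_fintype_card, Fintype.card_subtype, Finset.card_filter,
      Fintype.sum_sum_type, Fin.sum_univ_five]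
    simp

lemma ABCGG_S33_eq {m : ℕ} (hc : (S33 2 0 2 0 m).Connected)
    (hcard : (S33 2 0 2 0 m).edgeSet.ncard = Nat.card (SVert 2 0 2 0 m) + 1) :
    ABCGG (S33 2 0 2 0 m) = extremalValue (Nat.card (SVert 2 0 2 0 m)) := by
  obtain ⟨κ₁, κ₂, h, ⟨h1, h2⟩, h3, h4⟩ := exists_isPendentButterfly_S33 hc
  refine h.ABCGG_eq hcard ?_ ?_ <;> unfold OptimalParts <;> omega

lemma IsOptimalTriangle.rotate {G : SimpleGraph V} {a : V} {c : G.Walk a a} {x y z : V}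
    {κ : V → V} (h : IsOptimalTriangle c x y z κ) : IsOptimalTriangle c y z x κ :=
  ⟨fun e => by rw [h.mem_edges]; tauto, fun v => by rw [h.mem_support]; tauto, h.isGate.rotate, by
    have := h.optimal
    unfold OptimalParts at *
    tauto⟩

lemma IsOptimalTriangle.reflect {G : SimpleGraph V} {a : V} {c : G.Walk a a} {x y z : V}
    {κ : V → V} (h : IsOptimalTriangle c x y z κ) : IsOptimalTriangle c x z y κ :=
  ⟨fun e => by
    rw [h.mem_edges, Sym2.eq_swap (a := x) (b := y), Sym2.eq_swap (a := y) (b := z),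
      Sym2.eq_swap (a := z) (b := x)]
    tauto,
  fun v => by rw [h.mem_support]; tauto, h.isGate.reflect, by
    have := h.optimal
    unfold OptimalParts at *
    tauto⟩

lemma IsOptimalTriangle.exists_sorted {G : SimpleGraph V} {a u : V} {c : G.Walk a a} {x y z : V}
    {κ : V → V} (h : IsOptimalTriangle c x y z κ) (hu : u ∈ c.support) :
    ∃ p q, IsOptimalTriangle c u p q κ ∧
      Nat.card {w // κ w = q} ≤ Nat.card {w // κ w = p} := by
  have key : ∃ p q, IsOptimalTriangle c u p q κ := by
    rcases (h.mem_support u).1 hu with rfl | rfl | rfl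
    exacts [⟨_, _, h⟩, ⟨_, _, h.rotate⟩, ⟨_, _, h.rotate.rotate⟩]
  obtain ⟨p, q, hpq⟩ := key
  rcases le_total (Nat.card {w // κ w = q}) (Nat.card {w // κ w = p}) with hle | hle
  exacts [⟨p, q, hpq, hle⟩, ⟨q, p, hpq.reflect, hle⟩]

lemma nonempty_iso_of_ABCGG_eq [Fintype V] {G : SimpleGraph V} (hG : G.Connected)
    (hcard : G.edgeSet.ncard = Nat.card V + 1) (hn1 : 10 ≤ Nat.card V) (hn2 : Nat.card V ≤ 15)
    {a b u : V} {c₁ : G.Walk a a} {c₂ : G.Walk b b} (h₁ : c₁.IsCycle) (h₂ : c₂.IsCycle)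
    (hm : MeetOnce c₁ c₂) (hu₁ : u ∈ c₁.support) (hu₂ : u ∈ c₂.support)
    (heq : ABCGG G = extremalValue (Nat.card V)) :
    Nonempty (G ≃g S33 2 0 2 0 (Nat.card V - 9)) := by
  obtain ⟨⟨_, _, _, κ₁, t₁⟩, ⟨_, _, _, κ₂, t₂⟩, hrest⟩ :=
    (ABCGG_le hG hcard hn1 hn2 h₁ h₂ hm).2 heq
  obtain ⟨p, q, t₁, hle₁⟩ := t₁.exists_sorted hu₁
  obtain ⟨p', q', t₂, hle₂⟩ := t₂.exists_sorted hu₂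
  have hne : ∀ {v w}, v ∈ c₁.support → w ∈ c₂.support → v ≠ u → v ≠ w := by
    rintro v _ hv hw hvu rfl
    exact hvu (hm v u hv hu₁ hw hu₂)
  have g₁ := t₁.isGate
  have g₂ := t₂.isGate
  have hp := (t₁.mem_support p).2 (by simp)
  have hq := (t₁.mem_support q).2 (by simp)
  have hp' := (t₂.mem_support p').2 (by simp)
  have hq' := (t₂.mem_support q').2 (by simp)
  have hbut : IsPendentButterfly G ![u, p, q, p', q'] κ₁ κ₂ := by
    refine ⟨hG, ?_, g₁, g₂, fun v w hvw => ?_⟩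
    · have n1 := g₁.xy.ne
      have n2 := g₁.yz.ne
      have n3 := g₁.zx.ne
      have n4 := g₂.xy.ne
      have n5 := g₂.yz.ne
      have n6 := g₂.zx.ne
      have n7 := hne hp hp' n1.symm
      have n8 := hne hp hq' n1.symm
      have n9 := hne hq hp' n3
      have n10 := hne hq hq' n3
      intro i j hij
      fin_cases i <;> fin_cases j <;> simp at hij ⊢ <;> grind
    · by_cases e1 : s(v, w) ∈ c₁.edges
      · rcases (t₁.mem_edges _).1 e1 with h | h | h
        exacts [Or.inl h, Or.inr (Or.inl h), Or.inr (Or.inr (Or.inl h))]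
      iterate 3 right
      by_cases e2 : s(v, w) ∈ c₂.edges
      · rcases (t₂.mem_edges _).1 e2 with h | h | h
        exacts [Or.inl h, Or.inr (Or.inl h), Or.inr (Or.inr (Or.inl h))]
      iterate 3 right
      obtain ⟨hs, h1 | h1⟩ := hrest v w hvw e1 e2
      · exact Or.inl (isLeafAt_of_sideCount_eq_one hG hvw hs h1)
      · exact Or.inr (isLeafAt_of_sideCount_eq_one hG hvw.symm (by omega) h1)
  obtain ⟨l0, l1, l2, l3, l4⟩ := hbut.leaf_cards hn1 t₁.optimal t₂.optimal hle₁ hle₂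
  exact hbut.nonempty_iso l0 l1 l2 l3 l4

end

theorem stmt14 {V : Type*} [Fintype V] (G : SimpleGraph V) (n r t : ℕ)
    (hn1 : 10 ≤ n) (hn2 : n ≤ 15) (hr : 3 ≤ r) (ht : 3 ≤ t) (hG : InSnrt G n r t) :
    ABCGG G ≤ 2 * (Real.sqrt (2 / 3) + Real.sqrt (((n : ℝ) - 5) / ((n : ℝ) - 4)) +
        Real.sqrt (((n : ℝ) - 3) / (3 * ((n : ℝ) - 4)))) +
      ((n : ℝ) - 5) * Real.sqrt (((n : ℝ) - 2) / ((n : ℝ) - 1)) ∧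
    (ABCGG G = 2 * (Real.sqrt (2 / 3) + Real.sqrt (((n : ℝ) - 5) / ((n : ℝ) - 4)) +
          Real.sqrt (((n : ℝ) - 3) / (3 * ((n : ℝ) - 4)))) +
        ((n : ℝ) - 5) * Real.sqrt (((n : ℝ) - 2) / ((n : ℝ) - 1)) ↔
      Nonempty (G ≃g S33 2 0 2 0 (n - 9))) := by
  obtain ⟨rfl, hconn, hcard, a, b, c₁, c₂, hc₁, hc₂, -, -, hinter⟩ := hG
  obtain ⟨u, hu⟩ := Set.ncard_eq_one.1 hinter
  have hmem : ∀ v, v ∈ c₁.support ∧ v ∈ c₂.support ↔ v = u := fun v => by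
    simpa using Set.ext_iff.1 hu v
  have hm : MeetOnce c₁ c₂ := fun v w h1 h2 h3 h4 =>
    ((hmem v).1 ⟨h1, h3⟩).trans ((hmem w).1 ⟨h2, h4⟩).symm
  obtain ⟨hu₁, hu₂⟩ := (hmem u).2 rfl
  rw [bound_eq hn1]
  rw [← Nat.card_eq_fintype_card] at hcard hn1 hn2 ⊢
  refine ⟨(ABCGG_le hconn hcard hn1 hn2 hc₁ hc₂ hm).1,
    nonempty_iso_of_ABCGG_eq hconn hcard hn1 hn2 hc₁ hc₂ hm hu₁ hu₂, fun ⟨f⟩ => ?_⟩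
  have hV := Nat.card_congr f.toEquiv
  rw [← Iso.ABCGG_eq f hconn, ABCGG_S33_eq (f.connected_iff.1 hconn)
    (by rw [Iso.ncard_edgeSet_eq f, hcard, ← hV]), ← hV, extremalValue]
end

section
/- Let n_1, n_2, n_3, n_4 ≥ 1 be integers with n = n_1 + n_2 + n_3 + n_4 and let G = B_n(n_1, n_2, n_3, n_4). (i) If n_2 ≥ 2, n_4 ≥ 2 and n_1 ≥ n_3 ≥ 2, then ABC_GG(G) < ABC_GG(B_n(n_1 + 1, n_2, n_3 − 1, n_4)). (ii) If n_2 ≥ n_4 ≥ 2 and n_3 = 1, then ABC_GG(G) < ABC_GG(B_n(n_1, n_2 + 1, n_3, n_4 − 1)). -/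
/-- Vertex type for `B_n(n1,n2,n3,n4)`: the four vertices `v1,v2,v3,v4` of `Q_4`
together with `n_i - 1` pendent vertices for each `i`. -/
abbrev BVert (n1 n2 n3 n4 : ℕ) : Type :=
  Fin 4 ⊕ Fin (n1 - 1) ⊕ Fin (n2 - 1) ⊕ Fin (n3 - 1) ⊕ Fin (n4 - 1)

/-- The graph `B_n(n1,n2,n3,n4)`: the 4-cycle `v1 v2 v3 v4` with chord `v1 v3`
(vertices `0,1,2,3` with chord `0–2`), and `n_i - 1` pendent vertices attached
to `v_i` for each `i = 1,2,3,4`. -/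
def Bgraph (n1 n2 n3 n4 : ℕ) : SimpleGraph (BVert n1 n2 n3 n4) :=
  SimpleGraph.fromRel (fun x y =>
    (x = Sum.inl 0 ∧ y = Sum.inl 1) ∨
    (x = Sum.inl 1 ∧ y = Sum.inl 2) ∨
    (x = Sum.inl 2 ∧ y = Sum.inl 3) ∨
    (x = Sum.inl 3 ∧ y = Sum.inl 0) ∨
    (x = Sum.inl 0 ∧ y = Sum.inl 2) ∨
    (∃ i : Fin (n1 - 1), x = Sum.inl 0 ∧ y = Sum.inr (Sum.inl i)) ∨
    (∃ i : Fin (n2 - 1), x = Sum.inl 1 ∧ y = Sum.inr (Sum.inr (Sum.inl i))) ∨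
    (∃ i : Fin (n3 - 1), x = Sum.inl 2 ∧ y = Sum.inr (Sum.inr (Sum.inr (Sum.inl i)))) ∨
    (∃ i : Fin (n4 - 1), x = Sum.inl 3 ∧ y = Sum.inr (Sum.inr (Sum.inr (Sum.inr i)))))

/-- A function that vanishes exactly at `u`, drops by at most one along every edge and
drops by exactly one along some edge at each vertex where it is nonzero is the distance to `u`. -/
theorem SimpleGraph.dist_eq_of_descent {V : Type*} (G : SimpleGraph V) (u : V) (f : V → ℕ)
    (hu : f u = 0) (hzero : ∀ x, f x = 0 → x = u)
    (hlip : ∀ x y, G.Adj x y → f x ≤ f y + 1)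
    (hdesc : ∀ x, f x ≠ 0 → ∃ y, G.Adj x y ∧ f y + 1 = f x) (x : V) :
    G.dist x u = f x := by
  have hwalk : ∀ k x, f x = k → ∃ p : G.Walk x u, p.length = k := by
    intro k
    induction k with
    | zero =>
      intro x hx
      obtain rfl := hzero x hx
      exact ⟨.nil, rfl⟩
    | succ k ih =>
      intro x hx
      obtain ⟨y, hxy, hy⟩ := hdesc x (by omega)
      obtain ⟨p, hp⟩ := ih y (by omega)
      exact ⟨.cons hxy p, by simp [hp]⟩
  have hlower : ∀ {x z : V} (p : G.Walk x z), f x ≤ f z + p.length := by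
    intro x z p
    induction p with
    | nil => simp
    | cons h p ih =>
      have := hlip _ _ h
      simp only [SimpleGraph.Walk.length_cons]
      omega
  obtain ⟨p, hp⟩ := hwalk _ x rfl
  obtain ⟨q, hq⟩ := SimpleGraph.Reachable.exists_walk_length_eq_dist ⟨p⟩
  have h₁ := SimpleGraph.dist_le p
  have h₂ := hlower q
  omega

namespace Bgraph

variable {n1 n2 n3 n4 : ℕ}

/-- The vertex of `Q_4` at which a vertex of `B_n` sits. -/
def hub : BVert n1 n2 n3 n4 → Fin 4
  | .inl i => i
  | .inr (.inl _) => 0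
  | .inr (.inr (.inl _)) => 1
  | .inr (.inr (.inr (.inl _))) => 2
  | .inr (.inr (.inr (.inr _))) => 3

/-- The distance of a vertex of `B_n` to its hub. -/
def depth : BVert n1 n2 n3 n4 → ℕ
  | .inl _ => 0
  | .inr _ => 1

/-- The distance in `Q_4`. -/
def coreDist (i j : Fin 4) : ℕ :=
  if i = j then 0 else if (i = 1 ∧ j = 3) ∨ (i = 3 ∧ j = 1) then 2 else 1

theorem adj_iff (x y : BVert n1 n2 n3 n4) :
    (Bgraph n1 n2 n3 n4).Adj x y ↔
      (depth x = 0 ∧ depth y = 0 ∧ coreDist (hub x) (hub y) = 1) ∨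
      (depth x + depth y = 1 ∧ hub x = hub y) := by
  rcases x with i | i | i | i | i <;> rcases y with j | j | j | j | j <;>
    simp [Bgraph, hub, depth] <;>
    first
      | (revert i j; decide)
      | grind

theorem hub_inl (i : Fin 4) : hub (.inl i : BVert n1 n2 n3 n4) = i := rfl

theorem depth_inl (i : Fin 4) : depth (.inl i : BVert n1 n2 n3 n4) = 0 := rfl

theorem coreDist_self (i : Fin 4) : coreDist i i = 0 := by simp [coreDist]

theorem coreDist_eq_zero {i j : Fin 4} (h : coreDist i j = 0) : i = j := by
  revert i j; decide

theorem coreDist_triangle {i j : Fin 4} (k : Fin 4) (h : coreDist i j = 1) :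
    coreDist i k ≤ coreDist j k + 1 := by
  revert i j k; decide

theorem exists_coreDist_descent {i k : Fin 4} (h : i ≠ k) :
    ∃ j, coreDist i j = 1 ∧ coreDist j k + 1 = coreDist i k := by
  revert i k; decide

theorem eq_inl_hub {x : BVert n1 n2 n3 n4} (h : depth x = 0) : x = .inl (hub x) := by
  rcases x with i | i <;> simp_all [depth, hub]

theorem depth_le_one (x : BVert n1 n2 n3 n4) : depth x ≤ 1 := by
  rcases x with i | i <;> simp [depth]

theorem dist_eq (x u : BVert n1 n2 n3 n4) :
    (Bgraph n1 n2 n3 n4).dist x u =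
      if x = u then 0 else depth x + depth u + coreDist (hub x) (hub u) := by
  refine SimpleGraph.dist_eq_of_descent _ u
    (fun x => if x = u then 0 else depth x + depth u + coreDist (hub x) (hub u))
    (by simp) ?_ ?_ ?_ x
  · intro x hx
    by_contra hne
    simp only [hne, if_false] at hx
    have hcore := coreDist_eq_zero (show coreDist (hub x) (hub u) = 0 by omega)
    rw [eq_inl_hub (show depth x = 0 by omega), eq_inl_hub (show depth u = 0 by omega),
      hcore] at hne
    exact hne rfl
  · intro x y hxy
    rw [adj_iff] at hxy
    by_cases hx : x = u
    · simp [hx]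
    by_cases hy : y = u
    · subst hy
      simp only [hx, if_true, if_false]
      rcases hxy with ⟨h₁, h₂, h₃⟩ | ⟨h₁, h₂⟩
      · omega
      · rw [h₂, coreDist_self]; omega
    · simp only [hx, hy, if_false]
      rcases hxy with ⟨h₁, h₂, h₃⟩ | ⟨h₁, h₂⟩
      · have := coreDist_triangle (hub u) h₃
        omega
      · rw [h₂]; omega
  · intro x hx
    have hxu : x ≠ u := by rintro rfl; simp at hx
    simp only [hxu, if_false]
    rcases Nat.lt_or_ge 0 (depth x) with hd | hd
    · have hd : depth x = 1 := le_antisymm (depth_le_one x) hd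
      refine ⟨.inl (hub x), ?_, ?_⟩
      · rw [adj_iff]; right; simp [hd, depth_inl, hub_inl]
      · by_cases h : (.inl (hub x) : BVert n1 n2 n3 n4) = u
        · rw [← h]; simp [hd, depth_inl, hub_inl, coreDist_self]
        · simp only [h, if_false, hd]
          simp only [depth_inl, hub_inl]
          omega
    · have hd : depth x = 0 := by omega
      by_cases hh : hub x = hub u
      · have hu : depth u ≠ 0 := fun hu => hxu <| by
          rw [eq_inl_hub hd, eq_inl_hub hu, hh]
        have hu : depth u = 1 := by have := depth_le_one u; omega
        refine ⟨u, ?_, ?_⟩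
        · rw [adj_iff]; right; simp [hd, hu, hh]
        · simp [hd, hu, hh, coreDist_self]
      · obtain ⟨j, hj₁, hj₂⟩ := exists_coreDist_descent hh
        refine ⟨.inl j, ?_, ?_⟩
        · rw [adj_iff]; left; simp [hd, depth_inl, hub_inl, hj₁]
        · by_cases h : (.inl j : BVert n1 n2 n3 n4) = u
          · subst h
            simp only [hub_inl, coreDist_self] at hj₂
            simp [hd, depth_inl, hub_inl, ← hj₂]
          · simp only [h, if_false, hd]
            simp only [depth_inl, hub_inl]
            omega

theorem dist_inl (x : BVert n1 n2 n3 n4) (i : Fin 4) :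
    (Bgraph n1 n2 n3 n4).dist x (.inl i) = depth x + coreDist (hub x) i := by
  rw [dist_eq]
  split_ifs with h
  · subst h; simp [depth, hub, coreDist_self]
  · simp [depth, hub]

theorem sum_comp_hub (h1 : 1 ≤ n1) (h2 : 1 ≤ n2) (h3 : 1 ≤ n3) (h4 : 1 ≤ n4)
    (g : Fin 4 → ℕ) :
    ∑ w : BVert n1 n2 n3 n4, g (hub w) = ∑ k, ![n1, n2, n3, n4] k * g k := by
  obtain ⟨m1, rfl⟩ := Nat.exists_eq_add_of_le' h1
  obtain ⟨m2, rfl⟩ := Nat.exists_eq_add_of_le' h2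
  obtain ⟨m3, rfl⟩ := Nat.exists_eq_add_of_le' h3
  obtain ⟨m4, rfl⟩ := Nat.exists_eq_add_of_le' h4
  simp [Fintype.sum_sum_type, Fin.sum_univ_four, hub]
  ring

theorem sideCount_inl_inl (h1 : 1 ≤ n1) (h2 : 1 ≤ n2) (h3 : 1 ≤ n3) (h4 : 1 ≤ n4)
    (i j : Fin 4) :
    sideCount (Bgraph n1 n2 n3 n4) (.inl i) (.inl j) =
      ∑ k : Fin 4, if coreDist k i < coreDist k j then ![n1, n2, n3, n4] k else 0 := by
  simp only [sideCount, dist_inl, add_lt_add_iff_left]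
  rw [Nat.card_eq_fintype_card, Fintype.card_subtype, Finset.card_filter,
    sum_comp_hub h1 h2 h3 h4 (fun k => if coreDist k i < coreDist k j then 1 else 0)]
  simp only [mul_ite, mul_one, mul_zero]

theorem dist_pendent_lt_iff {x : BVert n1 n2 n3 n4} (hx : depth x = 1)
    (w : BVert n1 n2 n3 n4) :
    (Bgraph n1 n2 n3 n4).dist w x < (Bgraph n1 n2 n3 n4).dist w (.inl (hub x)) ↔ w = x := by
  rw [dist_inl, dist_eq]
  split_ifs with h
  · subst h; simp [hx]
  · simp [h, hx]

theorem dist_hub_lt_iff {x : BVert n1 n2 n3 n4} (hx : depth x = 1)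
    (w : BVert n1 n2 n3 n4) :
    (Bgraph n1 n2 n3 n4).dist w (.inl (hub x)) < (Bgraph n1 n2 n3 n4).dist w x ↔ w ≠ x := by
  rw [dist_inl, dist_eq]
  split_ifs with h
  · subst h; simp
  · simp [h, hx]

theorem sideCount_pendent {x : BVert n1 n2 n3 n4} (hx : depth x = 1) :
    sideCount (Bgraph n1 n2 n3 n4) x (.inl (hub x)) = 1 := by
  simp [sideCount, dist_pendent_lt_iff hx]

theorem sideCount_hub (h1 : 1 ≤ n1) (h2 : 1 ≤ n2) (h3 : 1 ≤ n3) (h4 : 1 ≤ n4)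
    {x : BVert n1 n2 n3 n4} (hx : depth x = 1) :
    sideCount (Bgraph n1 n2 n3 n4) (.inl (hub x)) x = n1 + n2 + n3 + n4 - 1 := by
  simp only [sideCount, dist_hub_lt_iff hx]
  rw [Nat.card_eq_fintype_card, Fintype.card_subtype_compl, Fintype.card_subtype_eq]
  simp only [Fintype.card_sum, Fintype.card_fin]
  omega

/-- The contribution of an edge whose sides have `x` and `y` vertices. -/
noncomputable def edgeTerm (x y : ℝ) : ℝ := √((x + y - 2) / (x * y))

theorem edgeTerm_comm (x y : ℝ) : edgeTerm x y = edgeTerm y x := by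
  rw [edgeTerm, edgeTerm, add_comm, mul_comm]

theorem abcgg_eq (h1 : 1 ≤ n1) (h2 : 1 ≤ n2) (h3 : 1 ≤ n3) (h4 : 1 ≤ n4) :
    ABCGG (Bgraph n1 n2 n3 n4) =
      edgeTerm (n1 + n4) n2 + edgeTerm (n3 + n4) n2 + edgeTerm (n3 + n2) n4 +
        edgeTerm (n1 + n2) n4 + edgeTerm n1 n3 +
        (n1 + n2 + n3 + n4 - 4) * edgeTerm 1 (n1 + n2 + n3 + n4 - 1) := by
  classical
  have hpend : ∀ x : BVert n1 n2 n3 n4, depth x = 1 →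
      edgeTerm (sideCount (Bgraph n1 n2 n3 n4) x (.inl (hub x)))
        (sideCount (Bgraph n1 n2 n3 n4) (.inl (hub x)) x) =
      edgeTerm 1 (n1 + n2 + n3 + n4 - 1) := by
    intro x hx
    rw [sideCount_pendent hx, sideCount_hub h1 h2 h3 h4 hx, Nat.cast_sub (by omega)]
    push_cast
    rfl
  have hp1 (i) := hpend (.inr (.inl i)) rfl
  have hp2 (i) := hpend (.inr (.inr (.inl i))) rfl
  have hp3 (i) := hpend (.inr (.inr (.inr (.inl i)))) rfl
  have hp4 (i) := hpend (.inr (.inr (.inr (.inr i)))) rfl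
  have hp1' (i) := (edgeTerm_comm _ _).trans (hp1 i)
  have hp2' (i) := (edgeTerm_comm _ _).trans (hp2 i)
  have hp3' (i) := (edgeTerm_comm _ _).trans (hp3 i)
  have hp4' (i) := (edgeTerm_comm _ _).trans (hp4 i)
  simp only [hub] at hp1 hp2 hp3 hp4 hp1' hp2' hp3' hp4'
  have hdef : ABCGG (Bgraph n1 n2 n3 n4) = (1 / 2) * ∑ u, ∑ v,
      if (Bgraph n1 n2 n3 n4).Adj u v then
        edgeTerm (sideCount (Bgraph n1 n2 n3 n4) u v) (sideCount (Bgraph n1 n2 n3 n4) v u)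
      else 0 := by
    simp only [ABCGG, edgeTerm]
  rw [hdef]
  simp [Fintype.sum_sum_type, Fin.sum_univ_four, adj_iff, hub, depth, coreDist,
    hp1, hp2, hp3, hp4, hp1', hp2', hp3', hp4', sideCount_inl_inl h1 h2 h3 h4,
    Nat.cast_sub, h1, h2, h3, h4]
  rw [edgeTerm_comm n2 (n1 + n4), edgeTerm_comm n2 (n3 + n4), edgeTerm_comm n4 (n2 + n3),
    edgeTerm_comm n4 (n1 + n2), edgeTerm_comm n3 n1, add_comm (n3 : ℝ) n2]
  ring

end Bgraph

/-- The tangent-line inequality for the convex function `x ↦ √(A + B / x)`. -/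
theorem sqrt_add_div_tangent {A B x y : ℝ} (hA : 0 ≤ A) (hB : 0 < B) (hx : 0 < x) (hy : 0 < y) :
    √(A + B / x) - B / (2 * (x ^ 2 * √(A + B / x))) * (y - x) ≤ √(A + B / y) := by
  have hgx : 0 < √(A + B / x) := Real.sqrt_pos.2 (by positivity)
  have hsq : √(A + B / x) ^ 2 = A + B / x := Real.sq_sqrt (by positivity)
  have hprod : A + 2 * B / (x + y) ≤ √(A + B / x) * √(A + B / y) := by
    rw [← Real.sqrt_mul (by positivity)]
    apply Real.le_sqrt_of_sq_le
    have hid : (A + B / x) * (A + B / y) - (A + 2 * B / (x + y)) ^ 2 =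
        (A * B + B ^ 2 / (x + y)) * (x - y) ^ 2 / (x * y * (x + y)) := by
      field_simp
      ring
    have : 0 ≤ (A * B + B ^ 2 / (x + y)) * (x - y) ^ 2 / (x * y * (x + y)) := by positivity
    linarith
  have hlin : A + B / x - B * (y - x) / (2 * x ^ 2) ≤ A + 2 * B / (x + y) := by
    have hid : A + 2 * B / (x + y) - (A + B / x - B * (y - x) / (2 * x ^ 2)) =
        B * (x - y) ^ 2 / (2 * x ^ 2 * (x + y)) := by
      field_simp
      ring
    have : 0 ≤ B * (x - y) ^ 2 / (2 * x ^ 2 * (x + y)) := by positivity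
    linarith
  refine le_of_mul_le_mul_left ?_ hgx
  calc √(A + B / x) * (√(A + B / x) - B / (2 * (x ^ 2 * √(A + B / x))) * (y - x))
      = √(A + B / x) ^ 2 - B * (y - x) / (2 * x ^ 2) := by field_simp
    _ ≤ _ := by rw [hsq]; exact hlin.trans hprod

/-- Spreading out `q ≤ p` without increasing their sum does not decrease the sum of the values
of the convex antitone function `x ↦ √(A + B / x)`. -/
theorem sqrt_add_div_add_le {A B p q p' q' : ℝ} (hA : 0 ≤ A) (hB : 0 ≤ B) (hq' : 0 < q')
    (hp' : 0 < p') (hqq : q' ≤ q) (hqp : q ≤ p) (hsum : p' + q' ≤ p + q) :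
    √(A + B / p) + √(A + B / q) ≤ √(A + B / p') + √(A + B / q') := by
  rcases hB.eq_or_lt with rfl | hB
  · simp
  have hq : 0 < q := hq'.trans_le hqq
  have hp : 0 < p := hq.trans_le hqp
  have tp := sqrt_add_div_tangent hA hB hp hp'
  have tq := sqrt_add_div_tangent hA hB hq hq'
  have hgq : 0 < √(A + B / q) := Real.sqrt_pos.2 (by positivity)
  have hgp : 0 < √(A + B / p) := Real.sqrt_pos.2 (by positivity)
  have hslope : B / (2 * (p ^ 2 * √(A + B / p))) ≤ B / (2 * (q ^ 2 * √(A + B / q))) := by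
    have hmono : q ^ 2 * √(A + B / q) ≤ p ^ 2 * √(A + B / p) := by
      rw [← Real.sqrt_sq (show 0 ≤ q ^ 2 by positivity),
        ← Real.sqrt_sq (show 0 ≤ p ^ 2 by positivity),
        ← Real.sqrt_mul (by positivity), ← Real.sqrt_mul (by positivity)]
      apply Real.sqrt_le_sqrt
      have hq3 : (q ^ 2) ^ 2 * (A + B / q) = A * q ^ 4 + B * q ^ 3 := by field_simp
      have hp3 : (p ^ 2) ^ 2 * (A + B / p) = A * p ^ 4 + B * p ^ 3 := by field_simp
      rw [hq3, hp3]
      gcongr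
    gcongr
  have hpos : 0 ≤ B / (2 * (p ^ 2 * √(A + B / p))) := by positivity
  generalize B / (2 * (p ^ 2 * √(A + B / p))) = m at *
  generalize B / (2 * (q ^ 2 * √(A + B / q))) = k at *
  nlinarith [mul_nonneg hpos (sub_nonneg.2 hsum),
    mul_nonneg (sub_nonneg.2 hslope) (sub_nonneg.2 hqq)]

theorem one_div_sqrt_add_lt {p q p' q' : ℝ} (hq' : 0 < q') (hp' : 0 < p')
    (hqq : q' + 1 ≤ q) (hqp : q ≤ p) (hsum : p' + (q' + 1) ≤ p + q) :
    √(1 / p) + √(1 / q) < √(1 / p') + √(1 / q') := by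
  have h := sqrt_add_div_add_le (A := 0) (B := 1) le_rfl zero_le_one (by linarith) hp' hqq hqp hsum
  simp only [zero_add] at h
  have hlt : √(1 / (q' + 1)) < √(1 / q') :=
    Real.sqrt_lt_sqrt (by positivity) (one_div_lt_one_div_of_lt hq' (by linarith))
  linarith

namespace Bgraph

theorem edgeTerm_eq_sqrt_add_div {x y : ℝ} (hx : 0 < x) (hy : 0 < y) :
    edgeTerm x y = √(1 / y + (1 - 2 / y) / x) := by
  rw [edgeTerm]
  congr 1
  field_simp
  ring

theorem edgeTerm_add_le {p q y : ℝ} (hy : 2 ≤ y) (hq : 1 < q) (hqp : q ≤ p) :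
    edgeTerm p y + edgeTerm q y ≤ edgeTerm (p + 1) y + edgeTerm (q - 1) y := by
  have hy0 : 0 < y := by linarith
  rw [edgeTerm_eq_sqrt_add_div (by linarith) hy0, edgeTerm_eq_sqrt_add_div (by linarith) hy0,
    edgeTerm_eq_sqrt_add_div (by linarith) hy0, edgeTerm_eq_sqrt_add_div (by linarith) hy0]
  refine sqrt_add_div_add_le (by positivity) ?_ (by linarith) (by linarith) (by linarith) hqp
    (by linarith)
  rw [sub_nonneg, div_le_one hy0]
  exact hy

theorem edgeTerm_lt_of_unbalance {a c : ℝ} (hc : 2 ≤ c) (hca : c ≤ a) :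
    edgeTerm a c < edgeTerm (a + 1) (c - 1) := by
  refine Real.sqrt_lt_sqrt (div_nonneg (by linarith) (by nlinarith)) ?_
  rw [show a + 1 + (c - 1) - 2 = a + c - 2 by ring]
  exact div_lt_div_of_pos_left (by linarith) (by nlinarith) (by nlinarith)

theorem edgeTerm_eq_sqrt_mul {x y : ℝ} (h : 0 ≤ x + y - 2) :
    edgeTerm x y = √(x + y - 2) * √(1 / (x * y)) := by
  rw [edgeTerm, ← Real.sqrt_mul h, mul_one_div]

theorem edgeTerm_add_lt_of_shift {a b d : ℝ} (ha : 1 ≤ a) (hd : 2 ≤ d) (hdb : d ≤ b) :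
    edgeTerm (a + d) b + edgeTerm (a + b) d <
      edgeTerm (a + (d - 1)) (b + 1) + edgeTerm (a + (b + 1)) (d - 1) := by
  rw [edgeTerm_eq_sqrt_mul (by linarith), edgeTerm_eq_sqrt_mul (by linarith),
    edgeTerm_eq_sqrt_mul (by linarith), edgeTerm_eq_sqrt_mul (by linarith),
    show a + b + d - 2 = a + d + b - 2 by ring,
    show a + (d - 1) + (b + 1) - 2 = a + d + b - 2 by ring,
    show a + (b + 1) + (d - 1) - 2 = a + d + b - 2 by ring, ← mul_add, ← mul_add]
  refine mul_lt_mul_of_pos_left ?_ (Real.sqrt_pos.2 (by linarith))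
  apply one_div_sqrt_add_lt
  all_goals nlinarith

end Bgraph

theorem stmt16 (n1 n2 n3 n4 : ℕ)
    (h1 : 1 ≤ n1) (h2 : 1 ≤ n2) (h3 : 1 ≤ n3) (h4 : 1 ≤ n4) :
    ((2 ≤ n2 ∧ 2 ≤ n4 ∧ 2 ≤ n3 ∧ n3 ≤ n1) →
      ABCGG (Bgraph n1 n2 n3 n4) < ABCGG (Bgraph (n1 + 1) n2 (n3 - 1) n4)) ∧
    ((2 ≤ n4 ∧ n4 ≤ n2 ∧ n3 = 1) →
      ABCGG (Bgraph n1 n2 n3 n4) < ABCGG (Bgraph n1 (n2 + 1) n3 (n4 - 1))) := by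
  have r1 : (1 : ℝ) ≤ n1 := by exact_mod_cast h1
  constructor
  · rintro ⟨k2, k4, k3, k31⟩
    rw [Bgraph.abcgg_eq h1 h2 h3 h4, Bgraph.abcgg_eq (by omega) h2 (by omega) h4]
    have r2 : (2 : ℝ) ≤ n2 := by exact_mod_cast k2
    have r3 : (2 : ℝ) ≤ n3 := by exact_mod_cast k3
    have r4 : (2 : ℝ) ≤ n4 := by exact_mod_cast k4
    have r31 : (n3 : ℝ) ≤ n1 := by exact_mod_cast k31
    have e2 := Bgraph.edgeTerm_add_le (p := n1 + n4) (q := n3 + n4) r2 (by linarith) (by linarith)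
    have e4 := Bgraph.edgeTerm_add_le (p := n1 + n2) (q := n3 + n2) r4 (by linarith) (by linarith)
    have e13 := Bgraph.edgeTerm_lt_of_unbalance r3 r31
    push_cast [Nat.cast_sub h3]
    rw [add_right_comm, add_sub_right_comm] at e2 e4
    rw [show (n1 : ℝ) + 1 + n2 + (n3 - 1) + n4 = n1 + n2 + n3 + n4 by ring]
    linarith
  · rintro ⟨k4, k42, rfl⟩
    rw [Bgraph.abcgg_eq h1 h2 h3 h4, Bgraph.abcgg_eq h1 (by omega) h3 (by omega)]
    have r4 : (2 : ℝ) ≤ n4 := by exact_mod_cast k4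
    have r42 : (n4 : ℝ) ≤ n2 := by exact_mod_cast k42
    have e1 := Bgraph.edgeTerm_add_lt_of_shift r1 r4 r42
    have e3 := Bgraph.edgeTerm_add_lt_of_shift le_rfl r4 r42
    push_cast [Nat.cast_sub h4]
    rw [show (n1 : ℝ) + (n2 + 1) + 1 + (n4 - 1) = n1 + n2 + 1 + n4 by ring]
    linarith
end
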